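/- arXiv:2107.08225 — 9 statements merged into one kernel-verified Lean document; each statement's English description precedes it below -/
import Mathlib

section
/- Let α ≥ 0 and let x ∈ ℝ^n be a point at which the Mangasarian–Fromovitz constraint qualification holds. Then there exists v ∈ ℝ^n such that ⟨∇h_j(x), v⟩ + α h_j(x) = 0 for all j = 1,…,n_h and ⟨∇g_i(x), v⟩ + α g_i(x) > 0 for every i ∈ I_x. In particular the set V_α(x) is nonempty and Slater's condition holds for it. -/
open scoped RealInnerProductSpace

/-- The inner products of a vector with a linearly independent family can be prescribed. -/
theorem LinearIndependent.exists_inner_eq {E ι : Type*} [NormedAddCommGroup E]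
    [InnerProductSpace ℝ E] [FiniteDimensional ℝ E] {a : ι → E}
    (ha : LinearIndependent ℝ a) (c : ι → ℝ) : ∃ v : E, ∀ j, ⟪a j, v⟫ = c j := by
  obtain ⟨φ, hφ⟩ := LinearMap.exists_extend ((Module.Basis.span ha).constr ℝ c)
  refine ⟨(InnerProductSpace.toDual ℝ E).symm (LinearMap.toContinuousLinearMap φ), fun j => ?_⟩
  rw [real_inner_comm, InnerProductSpace.toDual_symm_apply]
  have hj := LinearMap.congr_fun hφ (Module.Basis.span ha j)
  rw [Module.Basis.constr_basis] at hj
  simpa [Module.Basis.span_apply] using hj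

/-- Finitely many affine functions with positive slopes are simultaneously positive somewhere. -/
theorem exists_forall_pos_add_mul {ι : Type*} [Finite ι] (P : ι → Prop) (a b : ι → ℝ)
    (hb : ∀ i, P i → 0 < b i) : ∃ t : ℝ, ∀ i, P i → 0 < a i + t * b i := by
  have H : ∀ᶠ t : ℝ in Filter.atTop, ∀ i, P i → 0 < a i + t * b i := by
    refine Filter.eventually_all.2 fun i => ?_
    by_cases hi : P i
    · have ht : Filter.Tendsto (fun t : ℝ => a i + t * b i) Filter.atTop Filter.atTop :=
        Filter.tendsto_atTop_add_const_left _ _ (Filter.tendsto_id.atTop_mul_const (hb i hi))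
      filter_upwards [ht.eventually_gt_atTop 0] with t h0 _ using h0
    · exact Filter.Eventually.of_forall fun _ h => absurd h hi
  exact H.exists

/-- Under the Mangasarian–Fromovitz constraint qualification at `x` and `α ≥ 0`,
there exists `v` with `⟪∇h_j(x), v⟫ + α h_j(x) = 0` for all `j` and
`⟪∇g_i(x), v⟫ + α g_i(x) > 0` for all active `i`; in particular `V_α(x)` is nonempty and
Slater's condition holds for it. -/
theorem stmt0
    {E : Type*} [NormedAddCommGroup E] [InnerProductSpace ℝ E] [FiniteDimensional ℝ E]
    {n ng nh : ℕ} (hn : 0 < n) (hdim : Module.finrank ℝ E = n)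
    (hng : 0 < ng) (hnh : 0 < nh)
    (f : E → ℝ) (g : Fin ng → E → ℝ) (h : Fin nh → E → ℝ)
    (gf : E → E) (gg : Fin ng → E → E) (gh : Fin nh → E → E)
    (hf : ∀ y, HasGradientAt f (gf y) y)
    (hg : ∀ i y, HasGradientAt (g i) (gg i y) y)
    (hh : ∀ j y, HasGradientAt (h j) (gh j y) y)
    (α : ℝ) (hα : 0 ≤ α) (x : E)
    (mfcq_li : LinearIndependent ℝ (fun j : Fin nh => gh j x))
    (mfcq_w : ∃ w : E, (∀ j : Fin nh, ⟪gh j x, w⟫ = 0) ∧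
      ∀ i : Fin ng, g i x ≤ 0 → 0 < ⟪gg i x, w⟫) :
    ∃ v : E, (∀ j : Fin nh, ⟪gh j x, v⟫ + α * h j x = 0) ∧
      (∀ i : Fin ng, g i x ≤ 0 → 0 < ⟪gg i x, v⟫ + α * g i x) ∧
      v ∈ {u : E | (∀ j : Fin nh, ⟪gh j x, u⟫ + α * h j x = 0) ∧
        ∀ i : Fin ng, g i x ≤ 0 → 0 ≤ ⟪gg i x, u⟫ + α * g i x} := by
  obtain ⟨w, hw, hw_pos⟩ := mfcq_w
  obtain ⟨u, hu⟩ := mfcq_li.exists_inner_eq fun j => -(α * h j x)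
  obtain ⟨t, ht⟩ := exists_forall_pos_add_mul (fun i => g i x ≤ 0)
    (fun i => ⟪gg i x, u⟫ + α * g i x) (fun i => ⟪gg i x, w⟫) hw_pos
  have heq : ∀ j, ⟪gh j x, u + t • w⟫ + α * h j x = 0 := fun j => by
    rw [inner_add_right, real_inner_smul_right, hu, hw]
    ring
  have hpos : ∀ i, g i x ≤ 0 → 0 < ⟪gg i x, u + t • w⟫ + α * g i x := fun i hi => by
    rw [inner_add_right, real_inner_smul_right]
    linarith [ht i hi]
  exact ⟨u + t • w, heq, hpos, heq, fun i hi => (hpos i hi).le⟩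
end

section
/- Let α ≥ 0 and let x : [0,∞) → ℝ^n be absolutely continuous, i.e., x(t) = x(0) + ∫₀ᵗ ẋ(τ)dτ with ẋ locally integrable, such that ẋ(t) ∈ V_α(x(t)) for almost every t ≥ 0. Then for every j and every t ≥ 0, h_j(x(t)) = h_j(x(0)) e^{−αt}, and for every i ∈ I_{x(0)} and every t ≥ 0, g_i(x(t)) ≥ g_i(x(0)) e^{−αt}. -/
open scoped RealInnerProductSpace
open MeasureTheory

open Set Filter

/-- A map whose increments are controlled by those of an absolutely continuous function is
absolutely continuous. -/
lemma AbsolutelyContinuousOnInterval.of_dist_le {X Y : Type*} [PseudoMetricSpace X]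
    [PseudoMetricSpace Y] {f : ℝ → X} {φ : ℝ → Y} {a b K : ℝ}
    (hφ : AbsolutelyContinuousOnInterval φ a b)
    (hle : ∀ s ∈ uIcc a b, ∀ t ∈ uIcc a b, dist (f s) (f t) ≤ K * dist (φ s) (φ t)) :
    AbsolutelyContinuousOnInterval f a b := by
  unfold AbsolutelyContinuousOnInterval at hφ ⊢
  refine squeeze_zero' (Eventually.of_forall fun E ↦ Finset.sum_nonneg fun _ _ ↦ dist_nonneg) ?_
    (by simpa using hφ.const_mul K)
  filter_upwards [mem_inf_of_right (mem_principal_self _)] with E hE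
  rw [Finset.mul_sum]
  exact Finset.sum_le_sum fun i hi ↦ hle _ (hE.1 i hi).1 _ (hE.1 i hi).2

/-- Indefinite integrals of vector-valued integrable functions are absolutely continuous. -/
lemma IntervalIntegrable.absolutelyContinuousOnInterval_integral {E : Type*}
    [NormedAddCommGroup E] [NormedSpace ℝ E] {f : ℝ → E} {a b : ℝ}
    (hf : IntervalIntegrable f volume a b) :
    AbsolutelyContinuousOnInterval (fun t ↦ ∫ τ in a..t, f τ) a b := by
  refine (hf.norm.absolutelyContinuousOnInterval_intervalIntegral left_mem_uIcc).of_dist_le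
    (K := 1) fun s hs t ht ↦ ?_
  have has := hf.mono_set (uIcc_subset_uIcc left_mem_uIcc hs)
  have hat := hf.mono_set (uIcc_subset_uIcc left_mem_uIcc ht)
  rw [one_mul, dist_eq_norm, dist_eq_norm,
    intervalIntegral.integral_interval_sub_left has hat,
    intervalIntegral.integral_interval_sub_left has.norm hat.norm]
  exact intervalIntegral.norm_integral_le_abs_integral_norm

/-- A `C¹` function of an absolutely continuous curve is absolutely continuous. -/
lemma ContDiff.comp_absolutelyContinuousOnInterval {E F : Type*}
    [NormedAddCommGroup E] [NormedSpace ℝ E] [NormedAddCommGroup F] [NormedSpace ℝ F]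
    {G : E → F} (hG : ContDiff ℝ 1 G) {y : ℝ → E} {a b : ℝ}
    (hy : AbsolutelyContinuousOnInterval y a b) :
    AbsolutelyContinuousOnInterval (fun t ↦ G (y t)) a b := by
  obtain ⟨K, hK⟩ := (hG.locallyLipschitz.locallyLipschitzOn
    (s := y '' uIcc a b)).exists_lipschitzOnWith_of_compact
      (isCompact_uIcc.image_of_continuousOn hy.continuousOn)
  exact hy.of_dist_le fun s hs t ht ↦
    hK.dist_le_mul _ (mem_image_of_mem y hs) _ (mem_image_of_mem y ht)

/-- A function with continuous gradient is `C¹`. -/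
lemma contDiff_one_of_hasGradientAt {E : Type*} [NormedAddCommGroup E] [InnerProductSpace ℝ E]
    [CompleteSpace E] {G : E → ℝ} {G' : E → E} (hG : ∀ y, HasGradientAt G (G' y) y)
    (hG' : Continuous G') : ContDiff ℝ 1 G := by
  refine contDiff_one_iff_fderiv.2 ⟨fun y ↦ (hG y).differentiableAt, ?_⟩
  rw [show fderiv ℝ G = fun y ↦ InnerProductSpace.toDual ℝ E (G' y) from
    funext fun y ↦ (hG y).hasFDerivAt.fderiv]
  exact (InnerProductSpace.toDual ℝ E).continuous.comp hG'

/-- An absolutely continuous function with almost everywhere nonnegative derivative at the points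
where it lies below its initial value never falls below that value. -/
lemma AbsolutelyContinuousOnInterval.le_of_ae_deriv_nonneg {ψ : ℝ → ℝ} {a b : ℝ} (hab : a ≤ b)
    (hψ : AbsolutelyContinuousOnInterval ψ a b)
    (hd : ∀ᵐ t, t ∈ Icc a b → ψ t ≤ ψ a → 0 ≤ deriv ψ t) : ψ a ≤ ψ b := by
  by_contra! hlt
  have hcont : ContinuousOn ψ (Icc a b) := uIcc_of_le hab ▸ hψ.continuousOn
  have hcomp : IsCompact (Icc a b ∩ ψ ⁻¹' Ici (ψ a)) :=
    isCompact_Icc.of_isClosed_subset (hcont.preimage_isClosed_of_isClosed isClosed_Icc isClosed_Ici)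
      inter_subset_left
  obtain ⟨s, ⟨hs, hsψ⟩, hmax⟩ := hcomp.exists_isGreatest ⟨a, left_mem_Icc.2 hab, le_refl (ψ a)⟩
  have hint := (hψ.mono (c := s) (d := b) (by
    rw [uIcc_of_le hs.2, uIcc_of_le hab]; exact Icc_subset_Icc_left hs.1)).integral_deriv_eq_sub
  have hnn : 0 ≤ ∫ t in s..b, deriv ψ t := by
    rw [intervalIntegral.integral_of_le hs.2]
    refine integral_nonneg_of_ae ((ae_restrict_iff' measurableSet_Ioc).2 ?_)
    filter_upwards [hd] with t ht hts
    have htI : t ∈ Icc a b := ⟨hs.1.trans hts.1.le, hts.2⟩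
    refine ht htI (le_of_not_ge fun hge ↦ ?_)
    exact absurd (hmax ⟨htI, hge⟩) (not_le.2 hts.1)
  have : ψ a ≤ ψ s := hsψ
  linarith

/-- Along the integral curve of `xd` started at `x₀`, a `C¹` function scaled by `exp (α t)` is
absolutely continuous, with the expected derivative almost everywhere. -/
lemma absolutelyContinuousOnInterval_exp_mul_comp_integral {E : Type*} [NormedAddCommGroup E]
    [InnerProductSpace ℝ E] [CompleteSpace E] {G : E → ℝ} {G' : E → E}
    (hG : ∀ y, HasGradientAt G (G' y) y) (hG' : Continuous G') (α : ℝ) (x₀ : E) {xd : ℝ → E}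
    {a b : ℝ} (hxd : IntervalIntegrable xd volume a b) :
    AbsolutelyContinuousOnInterval
      (fun t ↦ Real.exp (α * t) * G (x₀ + ∫ τ in a..t, xd τ)) a b ∧
    ∀ᵐ t, t ∈ uIcc a b →
      deriv (fun t ↦ Real.exp (α * t) * G (x₀ + ∫ τ in a..t, xd τ)) t =
        Real.exp (α * t) * (⟪G' (x₀ + ∫ τ in a..t, xd τ), xd t⟫ +
          α * G (x₀ + ∫ τ in a..t, xd τ)) := by
  constructor
  · have hexp : AbsolutelyContinuousOnInterval (fun t ↦ Real.exp (α * t)) a b :=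
      ContDiffOn.absolutelyContinuousOnInterval (by fun_prop)
    refine hexp.fun_mul (ContDiff.comp_absolutelyContinuousOnInterval
      (G := fun z ↦ G (x₀ + z)) ?_ hxd.absolutelyContinuousOnInterval_integral)
    exact (contDiff_one_of_hasGradientAt hG hG').comp (contDiff_const.add contDiff_id)
  · filter_upwards [hxd.ae_hasDerivAt_integral] with t ht hts
    have hy := (ht hts a left_mem_uIcc).const_add x₀
    have hGy := (hG (x₀ + ∫ τ in a..t, xd τ)).hasFDerivAt.comp_hasDerivAt t hy
    have hexp : HasDerivAt (fun t ↦ Real.exp (α * t)) (Real.exp (α * t) * α) t := by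
      simpa using ((hasDerivAt_id t).const_mul α).exp
    refine (hexp.mul hGy).deriv.trans ?_
    simp only [InnerProductSpace.toDual_apply_apply, Function.comp_apply]
    ring

/-- Along a curve, if `⟨∇G, ẋ⟩ + α G ≥ 0` almost everywhere on the set where `exp (α t) G` is at
most some bound `c` for its initial value, then `G` stays above the exponential
`exp (-α t) G (x 0)`. -/
lemma mul_exp_le_of_ae_inner_add_nonneg {E : Type*} [NormedAddCommGroup E]
    [InnerProductSpace ℝ E] [CompleteSpace E] {G : E → ℝ} {G' : E → E}
    (hG : ∀ y, HasGradientAt G (G' y) y) (hG' : Continuous G') {α : ℝ} {x xd : ℝ → E}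
    (hii : ∀ t : ℝ, IntervalIntegrable xd volume 0 t)
    (hxint : ∀ t : ℝ, 0 ≤ t → x t = x 0 + ∫ τ in (0 : ℝ)..t, xd τ)
    {c : ℝ} (hc : G (x 0) ≤ c)
    (hae : ∀ᵐ t, 0 ≤ t → G (x t) * Real.exp (α * t) ≤ c → 0 ≤ ⟪G' (x t), xd t⟫ + α * G (x t))
    {t : ℝ} (ht : 0 ≤ t) : G (x 0) * Real.exp (-(α * t)) ≤ G (x t) := by
  obtain ⟨hac, hderiv⟩ :=
    absolutelyContinuousOnInterval_exp_mul_comp_integral hG hG' α (x 0) (hii t)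
  have key := hac.le_of_ae_deriv_nonneg ht (by
    filter_upwards [hderiv, hae] with s hs hs' hst hle
    rw [hs (uIcc_of_le ht ▸ hst), ← hxint s hst.1]
    rw [← hxint s hst.1, ← hxint 0 le_rfl, mul_zero, Real.exp_zero, one_mul] at hle
    exact mul_nonneg (Real.exp_pos _).le (hs' hst.1 (by linarith)))
  rw [← hxint t ht, ← hxint 0 le_rfl, mul_zero, Real.exp_zero, one_mul] at key
  rwa [Real.exp_neg, ← div_eq_mul_inv, div_le_iff₀' (Real.exp_pos _)]

/-- if `x` is absolutely continuous (`x(t) = x(0) + ∫₀ᵗ ẋ`) with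
`ẋ(t) ∈ V_α(x(t))` for a.e. `t ≥ 0`, then `h_j(x(t)) = h_j(x(0)) e^{−αt}` for all `j`, and
`g_i(x(t)) ≥ g_i(x(0)) e^{−αt}` for all `i ∈ I_{x(0)}` and all `t ≥ 0`. -/
theorem stmt3
    {E : Type*} [NormedAddCommGroup E] [InnerProductSpace ℝ E] [FiniteDimensional ℝ E]
    {ng nh : ℕ} (hng : 0 < ng) (hnh : 0 < nh)
    (g : Fin ng → E → ℝ) (h : Fin nh → E → ℝ)
    (gg : Fin ng → E → E) (gh : Fin nh → E → E)
    (hg : ∀ i y, HasGradientAt (g i) (gg i y) y)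
    (hh : ∀ j y, HasGradientAt (h j) (gh j y) y)
    (hggc : ∀ i, Continuous (gg i)) (hghc : ∀ j, Continuous (gh j))
    (α : ℝ) (hα : 0 ≤ α)
    (x xd : ℝ → E)
    (hii : ∀ t : ℝ, IntervalIntegrable xd volume 0 t)
    (hxint : ∀ t : ℝ, 0 ≤ t → x t = x 0 + ∫ τ in (0 : ℝ)..t, xd τ)
    (hae : ∀ᵐ t ∂(volume : Measure ℝ), 0 ≤ t →
      (∀ j : Fin nh, ⟪gh j (x t), xd t⟫ + α * h j (x t) = 0) ∧
      ∀ i : Fin ng, g i (x t) ≤ 0 → 0 ≤ ⟪gg i (x t), xd t⟫ + α * g i (x t)) :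
    ∀ t : ℝ, 0 ≤ t →
      (∀ j : Fin nh, h j (x t) = h j (x 0) * Real.exp (-(α * t))) ∧
      ∀ i : Fin ng, g i (x 0) ≤ 0 → g i (x 0) * Real.exp (-(α * t)) ≤ g i (x t) := by
  have : CompleteSpace E := FiniteDimensional.complete ℝ E
  intro t ht
  refine ⟨fun j ↦ le_antisymm ?_ ?_, fun i hi ↦ ?_⟩
  · have hneg : ∀ y, HasGradientAt (fun z ↦ -h j z) (-gh j y) y := fun y ↦ by
      rw [hasGradientAt_iff_hasFDerivAt, map_neg]
      exact (hh j y).hasFDerivAt.neg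
    have key := mul_exp_le_of_ae_inner_add_nonneg hneg (hghc j).neg (α := α) hii hxint le_rfl (by
      filter_upwards [hae] with s hs hs0 _
      have := (hs hs0).1 j
      rw [inner_neg_left]
      linarith) ht
    linarith
  · refine mul_exp_le_of_ae_inner_add_nonneg (hh j) (hghc j) hii hxint le_rfl ?_ ht
    filter_upwards [hae] with s hs hs0 _
    exact ((hs hs0).1 j).ge
  · refine mul_exp_le_of_ae_inner_add_nonneg (hg i) (hggc i) hii hxint hi ?_ ht
    filter_upwards [hae] with s hs hs0 hle
    exact (hs hs0).2 i (nonpos_of_mul_nonpos_left hle (Real.exp_pos _))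
end

section
/- Let F : ℝ^n → ℝ be twice continuously differentiable and suppose there are constants 0 < μ ≤ L such that μ·Id ≼ ∇²F(y) ≼ L·Id for all y ∈ ℝ^n. Let α > 0, let 0 < T ≤ 2/(L + μ), fix x ∈ ℝ^n and set x⁺ := x − T∇F(x). Then F(x⁺) − (1/(2α))|∇F(x⁺)|² ≥ F(x) − (1/(2α))|∇F(x)|² + T(1 − μT/2)(μ/α − 1)|∇F(x)|². -/
open scoped RealInnerProductSpace

theorem norm_map_le_of_abs_inner_self_le {E : Type*} [NormedAddCommGroup E]
    [InnerProductSpace ℝ E] {B : E →L[ℝ] E} (hB : ∀ u v, ⟪B u, v⟫ = ⟪B v, u⟫) {c : ℝ}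
    (hc : ∀ v, |⟪B v, v⟫| ≤ c * ‖v‖ ^ 2) (u : E) : ‖B u‖ ≤ c * ‖u‖ := by
  rcases eq_or_ne (B u) 0 with h0 | h0
  · rcases eq_or_ne u 0 with rfl | hu
    · simp
    · have hu' : 0 < ‖u‖ := norm_pos_iff.2 hu
      have h := (abs_nonneg _).trans (hc u)
      rw [h0, norm_zero]
      nlinarith
  have hs : 0 < ‖B u‖ := norm_pos_iff.2 h0
  have hr : 0 < ‖u‖ := norm_pos_iff.2 fun h => h0 (by simp [h])
  have polarization (a b : E) : 4 * ⟪B a, b⟫ ≤ 2 * c * (‖a‖ ^ 2 + ‖b‖ ^ 2) := by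
    have h1 := (abs_le.1 (hc (a + b))).2
    have h2 := (abs_le.1 (hc (a - b))).1
    have h3 := parallelogram_law_with_norm ℝ a b
    simp only [map_add, map_sub, inner_add_left, inner_add_right, inner_sub_left,
      inner_sub_right, hB b a] at h1 h2
    linear_combination h1 + h2 + c * h3
  have h := polarization (‖B u‖ • u) (‖u‖ • B u)
  simp only [map_smul, real_inner_smul_left, real_inner_smul_right, real_inner_self_eq_norm_sq,
    norm_smul, norm_norm] at h
  have hp : 0 < ‖u‖ * ‖B u‖ ^ 2 := by positivity
  refine le_of_mul_le_mul_left ?_ hp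
  linear_combination h / 4

theorem inner_hessian_comm {E : Type*} [NormedAddCommGroup E] [InnerProductSpace ℝ E]
    [CompleteSpace E] {F : E → ℝ} {gF : E → E} (hgF : ∀ y, HasGradientAt F (gF y) y)
    {H : E →L[ℝ] E} {y : E} (hH : HasFDerivAt gF H y) (u v : E) :
    ⟪H u, v⟫ = ⟪H v, u⟫ := by
  let J : E →L[ℝ] E →L[ℝ] ℝ := (isBoundedBilinearMap_inner (𝕜 := ℝ) (E := E)).toContinuousLinearMap
  have h1 (z : E) : HasFDerivAt F (J (gF z)) z := (hgF z).hasFDerivAt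
  have h2 : HasFDerivAt (fun z => J (gF z)) (J.comp H) y := J.hasFDerivAt.comp y hH
  exact second_derivative_symmetric h1 h2 u v

theorem norm_sub_smul_gradient_sub_le {E : Type*} [NormedAddCommGroup E]
    [InnerProductSpace ℝ E] [CompleteSpace E]
    {F : E → ℝ} {gF : E → E} (hgF : ∀ y, HasGradientAt F (gF y) y)
    {HF : E → E →L[ℝ] E} (hHF : ∀ y, HasFDerivAt gF (HF y) y) {μ L T : ℝ}
    (hlow : ∀ y v : E, μ * ‖v‖ ^ 2 ≤ ⟪HF y v, v⟫)
    (hup : ∀ y v : E, ⟪HF y v, v⟫ ≤ L * ‖v‖ ^ 2)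
    (hT0 : 0 ≤ T) (hT : T * (L + μ) ≤ 2) (a b : E) :
    ‖(a - T • gF a) - (b - T • gF b)‖ ≤ (1 - μ * T) * ‖a - b‖ := by
  rcases subsingleton_or_nontrivial E with _ | _
  · simp [Subsingleton.elim a b]
  have bound (y u : E) :
      ‖(ContinuousLinearMap.id ℝ E - T • HF y) u‖ ≤ (1 - μ * T) * ‖u‖ := by
    refine norm_map_le_of_abs_inner_self_le (fun u v => ?_) (fun v => ?_) u
    · simp only [sub_apply, smul_apply, ContinuousLinearMap.id_apply, inner_sub_left,
        real_inner_smul_left, inner_hessian_comm hgF (hHF y) u v, real_inner_comm u v]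
    · have h1 := mul_le_mul_of_nonneg_left (hlow y v) hT0
      have h2 := mul_le_mul_of_nonneg_left (hup y v) hT0
      have h3 := mul_le_mul_of_nonneg_right hT (sq_nonneg ‖v‖)
      simp only [sub_apply, smul_apply, ContinuousLinearMap.id_apply, inner_sub_left,
        real_inner_smul_left, real_inner_self_eq_norm_sq]
      rw [abs_le]
      constructor <;> linarith
  have hc : 0 ≤ 1 - μ * T := by
    obtain ⟨v, hv⟩ := exists_ne (0 : E)
    exact nonneg_of_mul_nonneg_left ((norm_nonneg _).trans (bound a v)) (norm_pos_iff.2 hv)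
  exact convex_univ.norm_image_sub_le_of_norm_hasFDerivWithin_le
    (f := fun y => y - T • gF y)
    (fun y _ => ((hasFDerivAt_id y).sub ((hHF y).const_smul T)).hasFDerivWithinAt)
    (fun y _ => ContinuousLinearMap.opNorm_le_bound _ hc (bound y))
    (Set.mem_univ b) (Set.mem_univ a)

theorem le_sub_smul_of_gradient_strongly_monotone {E : Type*} [NormedAddCommGroup E]
    [InnerProductSpace ℝ E] [CompleteSpace E]
    {F : E → ℝ} {gF : E → E} (hgF : ∀ y, HasGradientAt F (gF y) y) {μ : ℝ}
    (hmono : ∀ a b : E, μ * ‖a - b‖ ^ 2 ≤ ⟪gF a - gF b, a - b⟫)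
    {T : ℝ} (hT : 0 ≤ T) (x v : E) :
    F x - T * ⟪gF x, v⟫ + μ * T ^ 2 / 2 * ‖v‖ ^ 2 ≤ F (x - T • v) := by
  let ψ : ℝ → ℝ := fun t => F (x - t • v) + t * ⟪gF x, v⟫ - t ^ 2 * (μ / 2 * ‖v‖ ^ 2)
  have hψ (t : ℝ) :
      HasDerivAt ψ (⟪gF x - gF (x - t • v), v⟫ - μ * t * ‖v‖ ^ 2) t := by
    have h1 : HasDerivAt (fun t : ℝ => x - t • v) (-v) t := by
      simpa using ((hasDerivAt_id t).smul_const v).const_sub x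
    have h2 := (hgF (x - t • v)).hasFDerivAt.comp_hasDerivAt t h1
    have h3 := (h2.add ((hasDerivAt_id t).mul_const ⟪gF x, v⟫)).sub
      ((hasDerivAt_pow 2 t).mul_const (μ / 2 * ‖v‖ ^ 2))
    refine h3.congr_deriv ?_
    simp [inner_sub_left]
    ring
  have hmon : MonotoneOn ψ (Set.Ici 0) := by
    refine monotoneOn_of_hasDerivWithinAt_nonneg (convex_Ici 0)
      (fun t _ => (hψ t).continuousAt.continuousWithinAt)
      (fun t _ => (hψ t).hasDerivWithinAt) fun t ht => ?_
    rw [interior_Ici, Set.mem_Ioi] at ht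
    have h := hmono x (x - t • v)
    simp only [sub_sub_cancel, norm_smul, real_inner_smul_right, mul_pow, Real.norm_eq_abs,
      sq_abs] at h
    refine nonneg_of_mul_nonneg_right ?_ ht
    linarith
  have h := hmon (Set.mem_Ici.2 le_rfl) (Set.mem_Ici.2 hT) hT
  simp only [ψ, zero_smul, sub_zero, zero_mul, add_zero] at h
  linarith

/-- the core one-step descent inequality.  If `F` is `C²` with
`μ·Id ≼ ∇²F(y) ≼ L·Id` for all `y` (eigenvalue bounds on the Hessian), `α > 0`,
`0 < T ≤ 2/(L+μ)` and `x⁺ = x − T∇F(x)`, then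
`F(x⁺) − (1/2α)‖∇F(x⁺)‖² ≥ F(x) − (1/2α)‖∇F(x)‖² + T(1 − μT/2)(μ/α − 1)‖∇F(x)‖²`. -/
theorem stmt8
    {E : Type*} [NormedAddCommGroup E] [InnerProductSpace ℝ E] [FiniteDimensional ℝ E]
    (F : E → ℝ) (hF : ContDiff ℝ 2 F)
    (gF : E → E) (hgF : ∀ y, HasGradientAt F (gF y) y)
    (HF : E → E →L[ℝ] E) (hHF : ∀ y, HasFDerivAt gF (HF y) y)
    {μ L : ℝ} (hμ : 0 < μ) (hμL : μ ≤ L)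
    (hlow : ∀ (y v : E), μ * ‖v‖^2 ≤ ⟪HF y v, v⟫)
    (hup : ∀ (y v : E), ⟪HF y v, v⟫ ≤ L * ‖v‖^2)
    {α T : ℝ} (hα : 0 < α) (hT0 : 0 < T) (hT : T ≤ 2 / (L + μ))
    (x : E) :
    F (x - T • gF x) - 1/(2*α) * ‖gF (x - T • gF x)‖^2 ≥
      F x - 1/(2*α) * ‖gF x‖^2 + T * (1 - μ*T/2) * (μ/α - 1) * ‖gF x‖^2 := by
  have hT' : T * (L + μ) ≤ 2 := (le_div_iff₀ (by linarith)).1 hT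
  have hlip := norm_sub_smul_gradient_sub_le hgF hHF hlow hup hT0.le hT'
  have hmono (a b : E) : μ * ‖a - b‖ ^ 2 ≤ ⟪gF a - gF b, a - b⟫ := by
    have h1 := (real_inner_le_norm ((a - T • gF a) - (b - T • gF b)) (a - b)).trans
      (mul_le_mul_of_nonneg_right (hlip a b) (norm_nonneg _))
    have h2 : (a - T • gF a) - (b - T • gF b) = (a - b) - T • (gF a - gF b) := by module
    rw [h2, inner_sub_left, real_inner_smul_left, real_inner_self_eq_norm_sq] at h1
    refine le_of_mul_le_mul_left ?_ hT0
    linarith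
  have hvalue := le_sub_smul_of_gradient_strongly_monotone hgF hmono hT0.le x (gF x)
  rw [real_inner_self_eq_norm_sq] at hvalue
  have hgrad : ‖gF (x - T • gF x)‖ ≤ (1 - μ * T) * ‖gF x‖ := by
    have h := hlip x (x - T • gF x)
    rw [sub_sub_cancel, sub_sub_cancel, norm_smul, norm_smul, Real.norm_of_nonneg hT0.le] at h
    refine le_of_mul_le_mul_left ?_ hT0
    linarith
  have hsq : ‖gF (x - T • gF x)‖ ^ 2 ≤ ((1 - μ * T) * ‖gF x‖) ^ 2 :=
    pow_le_pow_left₀ (norm_nonneg _) hgrad 2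
  have hsq' := mul_le_mul_of_nonneg_left hsq (by positivity : 0 ≤ 1 / (2 * α))
  have hsplit : T * (1 - μ * T / 2) * (μ / α - 1) * ‖gF x‖ ^ 2 =
      1 / (2 * α) * ‖gF x‖ ^ 2 - 1 / (2 * α) * ((1 - μ * T) * ‖gF x‖) ^ 2 -
        T * (1 - μ * T / 2) * ‖gF x‖ ^ 2 := by
    field_simp
    ring
  rw [hsplit]
  linarith
end

section
/- Assume MFCQ holds at every x ∈ ℝ^n, the convexity assumption holds, 0 < α < μ, and 0 < T ≤ 2/(L_l + μ). Let x_0 ∈ ℝ^n be arbitrary and define the iterates x_{k+1} := x_k + T v(x_k). Then for every k ≥ 0: d(x_k) ≤ f*, and d(x_{k+1}) ≥ d(x_k) + c₁ |v(x_k)|², where c₁ := T(1 − μT/2)(μ/α − 1) > 0. In particular the sequence d(x_k) is monotonically increasing and bounded above by f*. -/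
open scoped RealInnerProductSpace
open Filter

section GradientInequalities

variable {E : Type*} [NormedAddCommGroup E] [InnerProductSpace ℝ E] [CompleteSpace E]
  {φ : E → ℝ} {G : E → E} {μ L : ℝ}

lemma HasGradientAt.hasDerivAt_comp_lineMap {a x y : E} {t : ℝ}
    (hφ : HasGradientAt φ a (AffineMap.lineMap x y t)) :
    HasDerivAt (fun s : ℝ => φ (AffineMap.lineMap x y s)) ⟪a, y - x⟫ t := by
  have := hφ.hasFDerivAt.comp_hasDerivAt t AffineMap.hasDerivAt_lineMap
  rwa [InnerProductSpace.toDual_apply_apply] at this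

lemma ConvexOn.add_inner_gradient_le (hc : ConvexOn ℝ Set.univ φ) {a x : E}
    (hφ : HasGradientAt φ a x) (y : E) : φ x + ⟪a, y - x⟫ ≤ φ y := by
  have hline : ConvexOn ℝ Set.univ (fun s : ℝ => φ (AffineMap.lineMap x y s)) :=
    hc.comp_affineMap (AffineMap.lineMap x y : ℝ →ᵃ[ℝ] E)
  have hd : HasDerivAt (fun s : ℝ => φ (AffineMap.lineMap x y s)) ⟪a, y - x⟫ 0 :=
    HasGradientAt.hasDerivAt_comp_lineMap (by simpa using hφ)
  have := hline.le_slope_of_hasDerivAt (Set.mem_univ 0) (Set.mem_univ 1) one_pos hd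
  simp [slope_def_field] at this
  linarith

lemma ConcaveOn.le_add_inner_gradient (hc : ConcaveOn ℝ Set.univ φ) {a x : E}
    (hφ : HasGradientAt φ a x) (y : E) : φ y ≤ φ x + ⟪a, y - x⟫ := by
  have hneg : HasGradientAt (-φ) (-a) x := by
    rw [hasGradientAt_iff_hasFDerivAt, map_neg]
    exact hφ.hasFDerivAt.neg
  have := hc.neg.add_inner_gradient_le hneg y
  simp only [Pi.neg_apply, inner_neg_left] at this
  linarith

lemma StrongConvexOn.add_inner_gradient_add_le (hc : StrongConvexOn Set.univ μ φ) {a x : E}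
    (hφ : HasGradientAt φ a x) (y : E) : φ x + ⟪a, y - x⟫ + μ / 2 * ‖y - x‖ ^ 2 ≤ φ y := by
  have hgrad : HasGradientAt (fun z => φ z - μ / 2 * ‖z‖ ^ 2) (a - μ • x) x := by
    have hdual : InnerProductSpace.toDual ℝ E (a - μ • x) =
        InnerProductSpace.toDual ℝ E a - (μ / 2) • (2 • innerSL ℝ x) := by
      ext z
      simp
      ring
    rw [hasGradientAt_iff_hasFDerivAt, hdual]
    exact hφ.hasFDerivAt.sub ((hasStrictFDerivAt_norm_sq x).hasFDerivAt.const_mul (μ / 2))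
  have := (strongConvexOn_iff_convex.1 hc).add_inner_gradient_le hgrad y
  have hxy : ‖y - x‖ ^ 2 = ‖y‖ ^ 2 - 2 * ⟪x, y⟫ + ‖x‖ ^ 2 := by
    rw [norm_sub_sq_real, real_inner_comm]
  simp only [inner_sub_left, inner_sub_right, inner_smul_left, real_inner_self_eq_norm_sq,
    RCLike.conj_to_real] at this ⊢
  rw [hxy]
  linarith

/-- The descent lemma for a function with Lipschitz gradient. -/
lemma le_add_inner_add_of_lipschitz_gradient (hφ : ∀ x, HasGradientAt φ (G x) x)
    (hL : ∀ x y, ‖G x - G y‖ ≤ L * ‖x - y‖) (x y : E) :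
    φ y ≤ φ x + ⟪G x, y - x⟫ + L / 2 * ‖y - x‖ ^ 2 := by
  set ψ : ℝ → ℝ := fun t => φ (AffineMap.lineMap x y t) - t * ⟪G x, y - x⟫
    - t ^ 2 * (L / 2 * ‖y - x‖ ^ 2) with hψ
  have hd (t : ℝ) : HasDerivAt ψ (⟪G (AffineMap.lineMap x y t), y - x⟫ - 1 * ⟪G x, y - x⟫
      - 2 * t * (L / 2 * ‖y - x‖ ^ 2)) t := by
    refine (((hφ _).hasDerivAt_comp_lineMap).sub ((hasDerivAt_id t).mul_const _)).sub ?_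
    simpa using (hasDerivAt_pow 2 t).mul_const (L / 2 * ‖y - x‖ ^ 2)
  have hanti : AntitoneOn ψ (Set.Icc 0 1) := by
    refine antitoneOn_of_deriv_nonpos (convex_Icc 0 1)
      (fun t _ => (hd t).continuousAt.continuousWithinAt)
      (fun t _ => (hd t).differentiableAt.differentiableWithinAt) fun t ht => ?_
    rw [interior_Icc] at ht
    rw [(hd t).deriv, one_mul, ← inner_sub_left]
    have hdist : AffineMap.lineMap x y t - x = t • (y - x) := by
      simp [AffineMap.lineMap_apply]
    have h1 := hL (AffineMap.lineMap x y t) x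
    rw [hdist, norm_smul, Real.norm_of_nonneg ht.1.le] at h1
    have h2 := real_inner_le_norm (G (AffineMap.lineMap x y t) - G x) (y - x)
    have h3 := mul_le_mul_of_nonneg_right h1 (norm_nonneg (y - x))
    linarith
  have := hanti (Set.left_mem_Icc.2 zero_le_one) (Set.right_mem_Icc.2 zero_le_one) zero_le_one
  simp [hψ] at this
  linarith

end GradientInequalities

/-- A gradient step of length `T ≤ 2 / (L + μ)` contracts the gradient of a `μ`-strongly convex
`L`-smooth function by the factor `1 - μ * T`. -/
lemma norm_gradient_step_sq_le {E : Type*} [NormedAddCommGroup E] [InnerProductSpace ℝ E]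
    {φ : E → ℝ} {G : E → E} {μ L T : ℝ}
    (hlow : ∀ x y, φ x + ⟪G x, y - x⟫ + μ / 2 * ‖y - x‖ ^ 2 ≤ φ y)
    (hup : ∀ x y, φ y ≤ φ x + ⟪G x, y - x⟫ + L / 2 * ‖y - x‖ ^ 2)
    (hμL : μ ≤ L) (hT0 : 0 < T) (hT : T * (L + μ) ≤ 2) (x : E) :
    ‖G (x - T • G x)‖ ^ 2 ≤ (1 - μ * T) ^ 2 * ‖G x‖ ^ 2 := by
  set p := G x with hp
  set y := x - T • p with hy
  obtain ⟨D, hD⟩ : ∃ D, G y = (1 - μ * T) • p + D := ⟨G y - (1 - μ * T) • p, by abel⟩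
  have hDp : ⟪p, D⟫ = ⟪D, p⟫ := real_inner_comm _ _
  have key (s : ℝ) : (2 * s - (L - μ) * s ^ 2) * ‖D‖ ^ 2 ≤ -(T * ⟪D, p⟫) := by
    have h1 := (hlow y (x + s • D)).trans (hup x (x + s • D))
    have h2 := (hlow x (y - s • D)).trans (hup y (y - s • D))
    have e1 : x + s • D - y = s • D + T • p := by rw [hy]; abel
    have e2 : x + s • D - x = s • D := by abel
    have e3 : y - s • D - x = -(s • D + T • p) := by rw [hy]; abel
    have e4 : y - s • D - y = -(s • D) := by abel
    rw [e1, e2, ← hp, hD] at h1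
    rw [e3, e4, ← hp, hD] at h2
    rw [← real_inner_self_eq_norm_sq] at h1 h2 ⊢
    rw [← real_inner_self_eq_norm_sq] at h1 h2
    simp only [inner_add_left, inner_add_right, inner_smul_left, inner_smul_right, inner_neg_left,
      inner_neg_right, RCLike.conj_to_real, hDp] at h1 h2
    linarith
  have hexp : ‖G y‖ ^ 2 = (1 - μ * T) ^ 2 * ‖p‖ ^ 2 + 2 * (1 - μ * T) * ⟪D, p⟫ + ‖D‖ ^ 2 := by
    rw [hD, norm_add_sq_real, norm_smul, inner_smul_left, hDp, mul_pow, Real.norm_eq_abs, sq_abs]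
    simp only [RCLike.conj_to_real]
    ring
  have hμT : 0 ≤ 1 - μ * T := by nlinarith
  rw [hexp]
  suffices h : 2 * (1 - μ * T) * ⟪D, p⟫ + ‖D‖ ^ 2 ≤ 0 by linarith
  rcases hμL.eq_or_lt with rfl | hlt
  · have hD0 : ‖D‖ ^ 2 = 0 := by
      by_contra hne
      have hk := key ((-(T * ⟪D, p⟫) + 1) / (2 * ‖D‖ ^ 2))
      rw [sub_self, zero_mul, sub_zero, mul_assoc, div_mul_eq_mul_div, mul_div_assoc',
        mul_comm 2, mul_assoc, mul_comm (‖D‖ ^ 2), mul_div_cancel_right₀ _ (by positivity)] at hk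
      linarith
    have : D = 0 := by simpa using hD0
    simp [this]
  · have hM : 0 < L - μ := sub_pos.2 hlt
    have hk := key (1 / (L - μ))
    have hk' : ‖D‖ ^ 2 ≤ (L - μ) * -(T * ⟪D, p⟫) := by
      have := mul_le_mul_of_nonneg_left hk hM.le
      field_simp at this
      linarith
    have hb : T * ⟪D, p⟫ ≤ 0 := by nlinarith [sq_nonneg ‖D‖]
    have hb' : ⟪D, p⟫ ≤ 0 := nonpos_of_mul_nonpos_right hb hT0
    nlinarith

/-- First-order optimality at an interior point from one side of a quadratic perturbation bound. -/
lemma nonpos_of_forall_mul_le_sq_mul {b c K : ℝ} (hb : 0 < b)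
    (hK : ∀ s, 0 ≤ s → s ≤ b → s * c ≤ s ^ 2 * K) : c ≤ 0 := by
  by_contra! hc
  set s := min b (c / (2 * (|K| + 1))) with hs
  have hK1 : 0 < 2 * (|K| + 1) := by positivity
  have hs0 : 0 < s := lt_min hb (div_pos hc hK1)
  have h1 := hK s hs0.le (min_le_left _ _)
  have h2 : s * (2 * (|K| + 1)) ≤ c := (le_div_iff₀ hK1).1 (min_le_right _ _)
  have h3 : c ≤ s * K := by
    have : s * c ≤ s * (s * K) := by linarith
    exact le_of_mul_le_mul_left this hs0
  nlinarith [le_abs_self K]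

section Lagrangian

variable {E ι κ : Type*} [Fintype ι] [Fintype κ]

/-- The Lagrangian `f - ∑ a j * h j - ∑ b i * g i`. -/
def lagrangian (f : E → ℝ) (h : ι → E → ℝ) (g : κ → E → ℝ) (a : ι → ℝ) (b : κ → ℝ) (x : E) : ℝ :=
  f x - ((∑ j, a j * h j x) + ∑ i, b i * g i x)

lemma lagrangian_add_single [DecidableEq κ] {f : E → ℝ} {h : ι → E → ℝ} {g : κ → E → ℝ}
    {a : ι → ℝ} {b : κ → ℝ} (x : E) (i : κ) (t : ℝ) :
    lagrangian f h g a (b + Pi.single i t) x = lagrangian f h g a b x - t * g i x := by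
  simp only [lagrangian, Pi.add_apply, add_mul, Finset.sum_add_distrib, Pi.single_apply, ite_mul,
    zero_mul, Finset.sum_ite_eq', Finset.mem_univ, if_true]
  ring

variable [NormedAddCommGroup E] [InnerProductSpace ℝ E]

/-- The gradient of the Lagrangian in terms of the gradients of its constituents. -/
def lagrangianGradient (gf : E → E) (gh : ι → E → E) (gg : κ → E → E) (a : ι → ℝ) (b : κ → ℝ)
    (x : E) : E :=
  gf x - ((∑ j, a j • gh j x) + ∑ i, b i • gg i x)

variable {f : E → ℝ} {h : ι → E → ℝ} {g : κ → E → ℝ} {gf : E → E} {gh : ι → E → E}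
  {gg : κ → E → E} {a : ι → ℝ} {b : κ → ℝ} {μ α : ℝ}

lemma hasGradientAt_lagrangian [CompleteSpace E] {x : E} (hf : HasGradientAt f (gf x) x)
    (hh : ∀ j, HasGradientAt (h j) (gh j x) x) (hg : ∀ i, HasGradientAt (g i) (gg i x) x) :
    HasGradientAt (lagrangian f h g a b) (lagrangianGradient gf gh gg a b x) x := by
  rw [hasGradientAt_iff_hasFDerivAt, lagrangianGradient]
  simp only [map_sub, map_add, map_sum, map_smul]
  exact hf.hasFDerivAt.sub
    ((HasFDerivAt.fun_sum fun j _ => (hh j).hasFDerivAt.const_mul (a j)).add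
      (HasFDerivAt.fun_sum fun i _ => (hg i).hasFDerivAt.const_mul (b i)))

lemma lagrangian_add_inner_add_le {x y : E}
    (hf : f x + ⟪gf x, y - x⟫ + μ / 2 * ‖y - x‖ ^ 2 ≤ f y)
    (hh : ∀ j, h j y = h j x + ⟪gh j x, y - x⟫)
    (hg : ∀ i, g i y ≤ g i x + ⟪gg i x, y - x⟫) (hb : ∀ i, 0 ≤ b i) :
    lagrangian f h g a b x + ⟪lagrangianGradient gf gh gg a b x, y - x⟫ + μ / 2 * ‖y - x‖ ^ 2 ≤
      lagrangian f h g a b y := by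
  have h1 : ∑ j, a j * h j y = (∑ j, a j * h j x) + ∑ j, a j * ⟪gh j x, y - x⟫ := by
    rw [← Finset.sum_add_distrib]
    exact Finset.sum_congr rfl fun j _ => by rw [hh j, mul_add]
  have h2 : ∑ i, b i * g i y ≤ (∑ i, b i * g i x) + ∑ i, b i * ⟪gg i x, y - x⟫ := by
    rw [← Finset.sum_add_distrib]
    exact Finset.sum_le_sum fun i _ => by
      rw [← mul_add]
      exact mul_le_mul_of_nonneg_left (hg i) (hb i)
  simp only [lagrangian, lagrangianGradient, inner_sub_left, inner_add_left, sum_inner,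
    inner_smul_left, RCLike.conj_to_real]
  linarith

lemma lagrangianGradient_add_single [DecidableEq κ] (x : E) (i : κ) (t : ℝ) :
    lagrangianGradient gf gh gg a (b + Pi.single i t) x =
      lagrangianGradient gf gh gg a b x - t • gg i x := by
  simp only [lagrangianGradient, Pi.add_apply, add_smul, Finset.sum_add_distrib, Pi.single_apply,
    ite_smul, zero_smul, Finset.sum_ite_eq', Finset.mem_univ, if_true]
  abel

/-- At a maximizer `(a, b)` of the dual objective at `x`, a constraint with positive multiplier is
tight or violated along the negative gradient of the Lagrangian. -/
lemma inner_gradient_add_nonpos_of_dual_maximizer (hα : 0 < α) {x : E}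
    (hb : ∀ i, 0 ≤ b i) (hsupp : ∀ i, 0 < g i x → b i = 0)
    (hmax : ∀ b' : κ → ℝ, (∀ i, 0 ≤ b' i) → (∀ i, 0 < g i x → b' i = 0) →
      lagrangian f h g a b' x - 1 / (2 * α) * ‖lagrangianGradient gf gh gg a b' x‖ ^ 2 ≤
        lagrangian f h g a b x - 1 / (2 * α) * ‖lagrangianGradient gf gh gg a b x‖ ^ 2)
    {i : κ} (hi : 0 < b i) :
    ⟪gg i x, -lagrangianGradient gf gh gg a b x⟫ + α * g i x ≤ 0 := by
  classical
  refine nonpos_of_forall_mul_le_sq_mul (K := ‖gg i x‖ ^ 2 / 2) hi fun s hs0 hs => ?_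
  have hgi : ¬ 0 < g i x := fun hpos => hi.ne' (hsupp i hpos)
  have key := hmax (b + Pi.single i (-s))
    (fun k => by
      rcases eq_or_ne k i with rfl | hk
      · simpa using hs
      · simpa [hk] using hb k)
    (fun k hk => by
      have hki : k ≠ i := fun hki => hgi (hki ▸ hk)
      simpa [hki] using hsupp k hk)
  rw [lagrangian_add_single, lagrangianGradient_add_single, norm_sub_sq_real, norm_smul, mul_pow,
    inner_smul_right, real_inner_comm, Real.norm_eq_abs, sq_abs] at key
  rw [inner_neg_right]
  have := mul_le_mul_of_nonneg_left key hα.le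
  field_simp at this
  linarith

end Lagrangian

/-- under MFCQ everywhere, the convexity assumption, `0 < α < μ`, and
`0 < T ≤ 2/(L_l + μ)`, the iterates `x_{k+1} = x_k + T v(x_k)` satisfy `d(x_k) ≤ f*` and
`d(x_{k+1}) ≥ d(x_k) + c₁ ‖v(x_k)‖²` with `c₁ = T(1 − μT/2)(μ/α − 1) > 0`; in particular
`d(x_k)` is monotonically increasing and bounded above by `f*`. -/
theorem stmt9
    {E : Type*} [NormedAddCommGroup E] [InnerProductSpace ℝ E] [FiniteDimensional ℝ E]
    {ng nh : ℕ} (hng : 0 < ng) (hnh : 0 < nh)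
    (f : E → ℝ) (g : Fin ng → E → ℝ) (h : Fin nh → E → ℝ)
    (gf : E → E) (gg : Fin ng → E → E) (gh : Fin nh → E → E)
    (hf : ∀ y, HasGradientAt f (gf y) y)
    (hg : ∀ i y, HasGradientAt (g i) (gg i y) y)
    (hh : ∀ j y, HasGradientAt (h j) (gh j y) y)
    (hgfc : Continuous gf) (hggc : ∀ i, Continuous (gg i)) (hghc : ∀ j, Continuous (gh j))
    -- Lipschitz gradients
    (Lf Lg Lh : ℝ)
    (hgfL : ∀ y z, ‖gf y - gf z‖ ≤ Lf * ‖y - z‖)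
    (hggL : ∀ i y z, ‖gg i y - gg i z‖ ≤ Lg * ‖y - z‖)
    (hghL : ∀ j y z, ‖gh j y - gh j z‖ ≤ Lh * ‖y - z‖)
    -- MFCQ at every point
    (mfcq : ∀ x : E, LinearIndependent ℝ (fun j : Fin nh => gh j x) ∧
      ∃ w : E, (∀ j : Fin nh, ⟪gh j x, w⟫ = 0) ∧
        ∀ i : Fin ng, g i x ≤ 0 → 0 < ⟪gg i x, w⟫)
    -- convexity assumption
    (hhaff : ∀ j, ConvexOn ℝ Set.univ (h j) ∧ ConcaveOn ℝ Set.univ (h j))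
    (hgconc : ∀ i, ConcaveOn ℝ Set.univ (g i))
    {μ : ℝ} (hμ : 0 < μ) (hfsc : StrongConvexOn Set.univ μ f)
    (hcoer : Tendsto f (cocompact E) atTop)
    (hCne : {y : E | (∀ i, 0 ≤ g i y) ∧ ∀ j, h j y = 0}.Nonempty)
    (hCbd : Bornology.IsBounded {y : E | (∀ i, 0 ≤ g i y) ∧ ∀ j, h j y = 0})
    (xstar : E) (hxsC : (∀ i, 0 ≤ g i xstar) ∧ ∀ j, h j xstar = 0)
    (hxsmin : ∀ y : E, ((∀ i, 0 ≤ g i y) ∧ ∀ j, h j y = 0) → f xstar ≤ f y)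
    -- parameter range
    {α : ℝ} (hα0 : 0 < α) (hαμ : α < μ)
    -- the maximizer `λ(·) = (lamh ·, lamg ·) ∈ D_x` of the dual, and the dual function `d`
    (lamh : E → Fin nh → ℝ) (lamg : E → Fin ng → ℝ)
    (hlam_nn : ∀ y i, 0 ≤ lamg y i)
    (hlam_supp : ∀ y i, 0 < g i y → lamg y i = 0)
    (dval : E → ℝ)
    (hd_eq : ∀ y : E, dval y =
      (f y - ((∑ j : Fin nh, lamh y j * h j y) + ∑ i : Fin ng, lamg y i * g i y)) -
        1/(2*α) * ‖gf y - ((∑ j : Fin nh, lamh y j • gh j y) +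
          ∑ i : Fin ng, lamg y i • gg i y)‖^2)
    (hd_max : ∀ (y : E) (lh : Fin nh → ℝ) (lg : Fin ng → ℝ),
      (∀ i, 0 ≤ lg i) → (∀ i, 0 < g i y → lg i = 0) →
      (f y - ((∑ j : Fin nh, lh j * h j y) + ∑ i : Fin ng, lg i * g i y)) -
        1/(2*α) * ‖gf y - ((∑ j : Fin nh, lh j • gh j y) +
          ∑ i : Fin ng, lg i • gg i y)‖^2 ≤ dval y)
    -- the velocity field `v(·)` and its relation to `λ(·)`
    (vfun : E → E)
    (hv_mem : ∀ y : E, (∀ j : Fin nh, ⟪gh j y, vfun y⟫ + α * h j y = 0) ∧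
      ∀ i : Fin ng, g i y ≤ 0 → 0 ≤ ⟪gg i y, vfun y⟫ + α * g i y)
    (hv_min : ∀ y u : E, (∀ j : Fin nh, ⟪gh j y, u⟫ + α * h j y = 0) →
      (∀ i : Fin ng, g i y ≤ 0 → 0 ≤ ⟪gg i y, u⟫ + α * g i y) →
      1/2 * ‖vfun y + gf y‖^2 ≤ 1/2 * ‖u + gf y‖^2)
    (hv_lam : ∀ y : E, vfun y =
      -(gf y - ((∑ j : Fin nh, lamh y j • gh j y) + ∑ i : Fin ng, lamg y i • gg i y)))
    -- the smoothness constant `L_l` of the Lagrangian with frozen multiplier `λ(x)`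
    {Ll : ℝ} (hμLl : μ ≤ Ll)
    (hLl : ∀ y z z' : E,
      ‖(gf z - ((∑ j : Fin nh, lamh y j • gh j z) + ∑ i : Fin ng, lamg y i • gg i z)) -
        (gf z' - ((∑ j : Fin nh, lamh y j • gh j z') +
          ∑ i : Fin ng, lamg y i • gg i z'))‖ ≤ Ll * ‖z - z'‖)
    -- step size
    {T : ℝ} (hT0 : 0 < T) (hT : T ≤ 2 / (Ll + μ))
    -- the iterates
    (xseq : ℕ → E)
    (hxs : ∀ k : ℕ, xseq (k + 1) = xseq k + T • vfun (xseq k)) :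
    0 < T * (1 - μ*T/2) * (μ/α - 1) ∧
    (∀ k : ℕ, dval (xseq k) ≤ f xstar) ∧
    (∀ k : ℕ, dval (xseq k) + T * (1 - μ*T/2) * (μ/α - 1) * ‖vfun (xseq k)‖^2 ≤
      dval (xseq (k + 1))) ∧
    Monotone (fun k => dval (xseq k)) := by
  have hLμ : 0 < Ll + μ := by linarith
  have hTL : T * (Ll + μ) ≤ 2 := (le_div_iff₀ hLμ).1 hT
  have hμT : μ * T ≤ 1 := by nlinarith
  have hαT : α * T ≤ 1 := by nlinarith
  have hc : 0 < T * (1 - μ * T / 2) * (μ / α - 1) :=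
    mul_pos (mul_pos hT0 (by linarith)) (sub_pos.2 ((one_lt_div hα0).2 hαμ))
  have hhlin (j : Fin nh) (x y : E) : h j y = h j x + ⟪gh j x, y - x⟫ :=
    le_antisymm ((hhaff j).2.le_add_inner_gradient (hh j x) y)
      ((hhaff j).1.add_inner_gradient_le (hh j x) y)
  set l : E → E → ℝ := fun x => lagrangian f h g (lamh x) (lamg x) with hl
  set G : E → E → E := fun x => lagrangianGradient gf gh gg (lamh x) (lamg x) with hG
  have hlow (x y z : E) : l x y + ⟪G x y, z - y⟫ + μ / 2 * ‖z - y‖ ^ 2 ≤ l x z :=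
    lagrangian_add_inner_add_le (hfsc.add_inner_gradient_add_le (hf y) z) (fun j => hhlin j y z)
      (fun i => (hgconc i).le_add_inner_gradient (hg i y) z) (hlam_nn x)
  have hup (x y z : E) : l x z ≤ l x y + ⟪G x y, z - y⟫ + Ll / 2 * ‖z - y‖ ^ 2 :=
    le_add_inner_add_of_lipschitz_gradient
      (fun w => hasGradientAt_lagrangian (hf w) (fun j => hh j w) fun i => hg i w) (hLl x) y z
  have hv (x : E) : vfun x = -G x x := hv_lam x
  have hd (x : E) : dval x = l x x - 1 / (2 * α) * ‖G x x‖ ^ 2 := hd_eq x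
  have hbound (x : E) : dval x ≤ f xstar := by
    have h1 : l x xstar ≤ f xstar := by
      have h2 : 0 ≤ ∑ i, lamg x i * g i xstar :=
        Finset.sum_nonneg fun i _ => mul_nonneg (hlam_nn x i) (hxsC.1 i)
      simp only [hl, lagrangian, hxsC.2, mul_zero, Finset.sum_const_zero]
      linarith
    have h2 := hlow x x xstar
    have h3 : 0 ≤ 1 / (2 * α) * ‖G x x + α • (xstar - x)‖ ^ 2 := by positivity
    rw [norm_add_sq_real, norm_smul, inner_smul_right, mul_pow, Real.norm_of_nonneg hα0.le] at h3
    have h4 : 1 / (2 * α) * (‖G x x‖ ^ 2 + 2 * (α * ⟪G x x, xstar - x⟫)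
        + α ^ 2 * ‖xstar - x‖ ^ 2) = 1 / (2 * α) * ‖G x x‖ ^ 2 + ⟪G x x, xstar - x⟫
        + α / 2 * ‖xstar - x‖ ^ 2 := by
      field_simp
    have h5 : α / 2 * ‖xstar - x‖ ^ 2 ≤ μ / 2 * ‖xstar - x‖ ^ 2 := by gcongr
    rw [hd]
    linarith
  have hstep (x : E) : dval x + T * (1 - μ * T / 2) * (μ / α - 1) * ‖vfun x‖ ^ 2 ≤
      dval (x + T • vfun x) := by
    set y := x + T • vfun x with hy
    have hyx : y - x = -(T • G x x) := by rw [hy, hv]; simp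
    have hy' : y = x - T • G x x := by rw [hy, hv, smul_neg, sub_eq_add_neg]
    have hsupp (i : Fin ng) (hi : 0 < g i y) : lamg x i = 0 := by
      by_contra hne
      have hpos : 0 < lamg x i := lt_of_le_of_ne (hlam_nn x i) (Ne.symm hne)
      have h1 : ⟪gg i x, -G x x⟫ + α * g i x ≤ 0 :=
        inner_gradient_add_nonpos_of_dual_maximizer hα0 (hlam_nn x) (hlam_supp x)
          (fun b hb hb' => (hd_max x (lamh x) b hb hb').trans_eq (hd_eq x)) hpos
      have h2 := (hgconc i).le_add_inner_gradient (hg i x) y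
      have h3 : g i x ≤ 0 := not_lt.1 fun hgt => hne (hlam_supp x i hgt)
      rw [hyx, ← smul_neg, inner_smul_right] at h2
      nlinarith
    have hdual : l x y - 1 / (2 * α) * ‖G x y‖ ^ 2 ≤ dval y :=
      hd_max y (lamh x) (lamg x) (hlam_nn x) hsupp
    have hcontr : ‖G x y‖ ^ 2 ≤ (1 - μ * T) ^ 2 * ‖G x x‖ ^ 2 := by
      rw [hy']
      exact norm_gradient_step_sq_le (hlow x) (hup x) hμLl hT0 hTL x
    have hdec := hlow x x y
    rw [hyx, norm_neg, norm_smul, mul_pow, inner_neg_right, inner_smul_right,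
      real_inner_self_eq_norm_sq, Real.norm_of_nonneg hT0.le] at hdec
    have hscaled := mul_le_mul_of_nonneg_left hcontr (by positivity : 0 ≤ 1 / (2 * α))
    have halg : T * (1 - μ * T / 2) * (μ / α - 1) * ‖G x x‖ ^ 2 =
        1 / (2 * α) * ‖G x x‖ ^ 2 - 1 / (2 * α) * ((1 - μ * T) ^ 2 * ‖G x x‖ ^ 2)
          - T * ‖G x x‖ ^ 2 + μ / 2 * (T ^ 2 * ‖G x x‖ ^ 2) := by
      field_simp
      ring
    rw [hd x, hv x, norm_neg, halg]
    linarith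
  have hseq (k : ℕ) : dval (xseq k) + T * (1 - μ * T / 2) * (μ / α - 1) * ‖vfun (xseq k)‖ ^ 2 ≤
      dval (xseq (k + 1)) := by
    rw [hxs]
    exact hstep _
  refine ⟨hc, fun k => hbound _, hseq, monotone_nat_of_le_succ fun k => ?_⟩
  have := mul_nonneg hc.le (sq_nonneg ‖vfun (xseq k)‖)
  linarith [hseq k]
end

section
/- Assume MFCQ holds at every x ∈ ℝ^n, the convexity assumption holds, 0 < α < μ, and 0 < T ≤ 2/(L_l + μ). Let x_0 ∈ ℝ^n and define x_{k+1} := x_k + T v(x_k). Then for every k ≥ 0, min_{0 ≤ j ≤ k} |v(x_j)|² ≤ (f* − d(x_0)) / (c₁ (k+1)), where c₁ := T(1 − μT/2)(μ/α − 1) > 0; moreover |v(x_k)| → 0 as k → ∞. -/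
open scoped RealInnerProductSpace
open Filter

/-- Cocoercivity of the gradient of a function lying above its tangents and below the
corresponding quadratic upper models. -/
lemma sq_norm_le_mul_inner_of_tangent_bounds {E : Type*} [NormedAddCommGroup E]
    [InnerProductSpace ℝ E] {φ : E → ℝ} {G : E → E} {M : ℝ} (hM : 0 ≤ M)
    (hlow : ∀ x y, φ x + ⟪G x, y - x⟫ ≤ φ y)
    (hup : ∀ x y, φ y ≤ φ x + ⟪G x, y - x⟫ + M / 2 * ‖y - x‖ ^ 2) (x y : E) :
    ‖G y - G x‖ ^ 2 ≤ M * ⟪G y - G x, y - x⟫ := by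
  have key : ∀ (x y : E) (t : ℝ),
      φ x + ⟪G x, y - x⟫ + (t - M * t ^ 2 / 2) * ‖G y - G x‖ ^ 2 ≤ φ y := fun x y t => by
    have h1 := hlow x (y - t • (G y - G x))
    have h2 := hup y (y - t • (G y - G x))
    have e1 : y - t • (G y - G x) - x = (y - x) - t • (G y - G x) := by abel
    have e2 : y - t • (G y - G x) - y = -(t • (G y - G x)) := by abel
    have e3 : ‖t • (G y - G x)‖ ^ 2 = t ^ 2 * ‖G y - G x‖ ^ 2 := by
      rw [norm_smul, mul_pow, Real.norm_eq_abs, sq_abs]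
    have e4 : ⟪G y, G y - G x⟫ - ⟪G x, G y - G x⟫ = ‖G y - G x‖ ^ 2 := by
      rw [← inner_sub_left, real_inner_self_eq_norm_sq]
    rw [e1, inner_sub_right, real_inner_smul_right] at h1
    rw [e2, inner_neg_right, norm_neg, e3, real_inner_smul_right] at h2
    linear_combination h1 + h2 - t * e4
  have both : ∀ t : ℝ, (2 * t - M * t ^ 2) * ‖G y - G x‖ ^ 2 ≤ ⟪G y - G x, y - x⟫ := fun t => by
    have h1 := key x y t
    have h2 := key y x t
    have e1 : ⟪G y, x - y⟫ = -⟪G y, y - x⟫ := by rw [← inner_neg_right, neg_sub]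
    rw [e1, norm_sub_rev] at h2
    rw [inner_sub_left]
    linarith
  rcases hM.eq_or_lt with rfl | hM
  · by_contra! hlt
    rw [zero_mul] at hlt
    have := both ((⟪G y - G x, y - x⟫ + 1) / (2 * ‖G y - G x‖ ^ 2))
    rw [zero_mul, sub_zero, ← mul_div_assoc, mul_div_mul_left _ _ two_ne_zero,
      div_mul_cancel₀ _ hlt.ne'] at this
    linarith
  · have := both M⁻¹
    field_simp at this
    linarith

section GradientInequalities

variable {E : Type*} [NormedAddCommGroup E] [InnerProductSpace ℝ E] [CompleteSpace E]

lemma HasGradientAt.hasDerivAt_comp_line {F : E → ℝ} {G x s : E} {t : ℝ}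
    (hF : HasGradientAt F G (x + t • s)) :
    HasDerivAt (fun r : ℝ => F (x + r • s)) ⟪G, s⟫ t := by
  have h1 : HasDerivAt (fun r : ℝ => x + r • s) s t := by
    simpa using ((hasDerivAt_id t).smul_const s).const_add x
  simpa [Function.comp_def] using hF.hasFDerivAt.comp_hasDerivAt t h1

lemma HasGradientAt.sum {ι : Type*} {u : Finset ι} {F : ι → E → ℝ} {G : ι → E} {x : E}
    (hF : ∀ i ∈ u, HasGradientAt (F i) (G i) x) :
    HasGradientAt (fun y => ∑ i ∈ u, F i y) (∑ i ∈ u, G i) x := by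
  rw [hasGradientAt_iff_hasFDerivAt, map_sum]
  exact HasFDerivAt.fun_sum fun i hi => (hF i hi).hasFDerivAt

lemma HasGradientAt.const_mul {F : E → ℝ} {G x : E} (c : ℝ) (hF : HasGradientAt F G x) :
    HasGradientAt (fun y => c * F y) (c • G) x := by
  rw [hasGradientAt_iff_hasFDerivAt]
  simpa using hF.hasFDerivAt.const_mul c

lemma HasGradientAt.add {F₁ F₂ : E → ℝ} {G₁ G₂ x : E} (h₁ : HasGradientAt F₁ G₁ x)
    (h₂ : HasGradientAt F₂ G₂ x) : HasGradientAt (fun y => F₁ y + F₂ y) (G₁ + G₂) x := by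
  rw [hasGradientAt_iff_hasFDerivAt, map_add]
  exact h₁.hasFDerivAt.fun_add h₂.hasFDerivAt

lemma HasGradientAt.sub {F₁ F₂ : E → ℝ} {G₁ G₂ x : E} (h₁ : HasGradientAt F₁ G₁ x)
    (h₂ : HasGradientAt F₂ G₂ x) : HasGradientAt (fun y => F₁ y - F₂ y) (G₁ - G₂) x := by
  rw [hasGradientAt_iff_hasFDerivAt, map_sub]
  exact h₁.hasFDerivAt.fun_sub h₂.hasFDerivAt

lemma ConvexOn.add_inner_le_of_hasGradientAt {F : E → ℝ} {G x : E}
    (hc : ConvexOn ℝ Set.univ F) (hF : HasGradientAt F G x) (y : E) :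
    F x + ⟪G, y - x⟫ ≤ F y := by
  have hline : ConvexOn ℝ Set.univ (fun r : ℝ => F (x + r • (y - x))) := by
    refine ⟨convex_univ, fun a _ b _ p q hp hq hpq => ?_⟩
    have := hc.2 (Set.mem_univ (x + a • (y - x))) (Set.mem_univ (x + b • (y - x))) hp hq hpq
    convert this using 2
    obtain rfl : q = 1 - p := by linarith
    simp only [smul_eq_mul]
    module
  have hd : HasDerivAt (fun r : ℝ => F (x + r • (y - x))) ⟪G, y - x⟫ 0 :=
    HasGradientAt.hasDerivAt_comp_line (by simpa using hF)
  have := hline.le_slope_of_hasDerivAt (Set.mem_univ 0) (Set.mem_univ 1) one_pos hd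
  simp [slope_def_field] at this
  linarith

lemma ConcaveOn.le_add_inner_of_hasGradientAt {F : E → ℝ} {G x : E}
    (hc : ConcaveOn ℝ Set.univ F) (hF : HasGradientAt F G x) (y : E) :
    F y ≤ F x + ⟪G, y - x⟫ := by
  have hF' : HasGradientAt (-F) (-G) x := by
    rw [hasGradientAt_iff_hasFDerivAt, map_neg]
    exact hF.hasFDerivAt.neg
  have := hc.neg.add_inner_le_of_hasGradientAt hF' y
  simp only [Pi.neg_apply, inner_neg_left] at this
  linarith

lemma StrongConvexOn.add_inner_add_sq_le_of_hasGradientAt {F : E → ℝ} {G x : E} {m : ℝ}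
    (hc : StrongConvexOn Set.univ m F) (hF : HasGradientAt F G x) (y : E) :
    F x + ⟪G, y - x⟫ + m / 2 * ‖y - x‖ ^ 2 ≤ F y := by
  have hn : HasGradientAt (fun z : E => ‖z‖ ^ 2) ((2 : ℝ) • x) x := by
    rw [hasGradientAt_iff_hasFDerivAt]
    refine (hasStrictFDerivAt_norm_sq x).hasFDerivAt.congr_fderiv ?_
    ext z
    simp
  have h := (strongConvexOn_iff_convex.1 hc).add_inner_le_of_hasGradientAt
    (hF.sub (hn.const_mul (m / 2))) y
  have h2 : ‖y - x‖ ^ 2 = ‖y‖ ^ 2 - 2 * ⟪x, y⟫ + ‖x‖ ^ 2 := by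
    rw [norm_sub_sq_real, real_inner_comm]
  have h3 : ⟪x, x⟫ = ‖x‖ ^ 2 := real_inner_self_eq_norm_sq x
  simp only [inner_sub_left, inner_sub_right, real_inner_smul_left, h3] at h ⊢
  rw [h2]
  linarith

/-- The descent lemma for a function with Lipschitz gradient. -/
lemma le_add_inner_add_sq_of_lipschitz_gradient {F : E → ℝ} {G : E → E} {L : ℝ}
    (hF : ∀ z, HasGradientAt F (G z) z) (hL : ∀ y z, ‖G y - G z‖ ≤ L * ‖y - z‖) (x y : E) :
    F y ≤ F x + ⟪G x, y - x⟫ + L / 2 * ‖y - x‖ ^ 2 := by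
  set s := y - x with hs
  have hd : ∀ t : ℝ, HasDerivAt
      (fun r : ℝ => F (x + r • s) - r * ⟪G x, s⟫ - r ^ 2 * (L / 2 * ‖s‖ ^ 2))
      (⟪G (x + t • s), s⟫ - ⟪G x, s⟫ - 2 * t * (L / 2 * ‖s‖ ^ 2)) t := fun t => by
    have h1 := (hF (x + t • s)).hasDerivAt_comp_line
    have h2 := (hasDerivAt_id t).mul_const ⟪G x, s⟫
    have h3 := (hasDerivAt_pow 2 t).mul_const (L / 2 * ‖s‖ ^ 2)
    simpa using (h1.fun_sub h2).fun_sub h3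
  have hanti := antitoneOn_of_hasDerivWithinAt_nonpos (convex_Ici (0 : ℝ))
    (fun t _ => (hd t).continuousAt.continuousWithinAt) (fun t _ => (hd t).hasDerivWithinAt)
    (fun t ht => by
      rw [interior_Ici, Set.mem_Ioi] at ht
      have h1 : ⟪G (x + t • s) - G x, s⟫ ≤ ‖G (x + t • s) - G x‖ * ‖s‖ := real_inner_le_norm _ _
      have h2 : ‖G (x + t • s) - G x‖ ≤ L * (t * ‖s‖) := by
        simpa [norm_smul, abs_of_pos ht] using hL (x + t • s) x
      have h3 := mul_le_mul_of_nonneg_right h2 (norm_nonneg s)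
      rw [inner_sub_left] at h1
      nlinarith)
  have := hanti (Set.mem_Ici.2 le_rfl) (Set.mem_Ici.2 zero_le_one) zero_le_one
  simp [hs] at this
  rw [← hs] at this
  linarith

/-- Contraction of the gradient norm along one gradient step of length at most `2 / (L + m)`. -/
lemma sq_norm_gradient_step_le {F : E → ℝ} {G : E → E} {m L T : ℝ} (hm : 0 < m) (hmL : m ≤ L)
    (hT0 : 0 < T) (hT : T ≤ 2 / (L + m)) (hF : ∀ z, HasGradientAt F (G z) z)
    (hlow : ∀ x y, F x + ⟪G x, y - x⟫ + m / 2 * ‖y - x‖ ^ 2 ≤ F y)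
    (hL : ∀ y z, ‖G y - G z‖ ≤ L * ‖y - z‖) (x : E) :
    ‖G (x - T • G x)‖ ^ 2 ≤ (1 - m * T) ^ 2 * ‖G x‖ ^ 2 := by
  have hup := le_add_inner_add_sq_of_lipschitz_gradient hF hL
  have hsq : ∀ x y : E, ‖y‖ ^ 2 = ‖x‖ ^ 2 + 2 * ⟪x, y - x⟫ + ‖y - x‖ ^ 2 := fun x y => by
    rw [← norm_add_sq_real, add_sub_cancel]
  have hco := sq_norm_le_mul_inner_of_tangent_bounds (φ := fun z => F z - m / 2 * ‖z‖ ^ 2)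
    (G := fun z => G z - m • z) (sub_nonneg.2 hmL)
    (fun x y => by
      rw [inner_sub_left, real_inner_smul_left]
      linear_combination hlow x y + m / 2 * hsq x y)
    (fun x y => by
      rw [inner_sub_left, real_inner_smul_left]
      linear_combination hup x y - m / 2 * hsq x y)
    x (x - T • G x)
  have hlow1 := hlow x (x - T • G x)
  have hlow2 := hlow (x - T • G x) x
  set a := G x with ha
  set b := G (x - T • a) with hb
  have e1 : x - T • a - x = -(T • a) := by abel
  have e2 : b - m • (x - T • a) - (a - m • x) = b - (1 - m * T) • a := by module
  have e3 : x - (x - T • a) = T • a := by abel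
  have e4 : ‖T • a‖ ^ 2 = T ^ 2 * ‖a‖ ^ 2 := by
    rw [norm_smul, mul_pow, Real.norm_eq_abs, sq_abs]
  simp only [e1, e2] at hco
  rw [e1, norm_neg, e4, inner_neg_right, real_inner_smul_right,
    real_inner_self_eq_norm_sq] at hlow1
  rw [e3, e4, real_inner_smul_right] at hlow2
  rw [norm_sub_sq_real, norm_smul, mul_pow, Real.norm_eq_abs, sq_abs, inner_neg_right,
    real_inner_smul_right, real_inner_smul_right, inner_sub_left, real_inner_smul_left,
    real_inner_self_eq_norm_sq] at hco
  have hT' : T * (L + m) ≤ 2 := (le_div_iff₀ (by linarith)).1 hT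
  have hba : ⟪b, a⟫ ≤ (1 - m * T) * ‖a‖ ^ 2 := by
    have : T * ⟪b, a⟫ ≤ T * ((1 - m * T) * ‖a‖ ^ 2) := by nlinarith
    exact le_of_mul_le_mul_left this hT0
  nlinarith [mul_nonneg (sub_nonneg.2 hT') (sub_nonneg.2 hba)]

end GradientInequalities

/-- Sufficient increase of a bounded above sequence yields the `1 / (k + 1)` best-iterate rate and
convergence of the increments to zero. -/
lemma exists_le_div_and_tendsto_of_sufficient_increase {a e : ℕ → ℝ} {c B : ℝ} (hc : 0 < c)
    (ha : ∀ k, 0 ≤ a k) (hinc : ∀ k, c * a k ≤ e (k + 1) - e k) (hB : ∀ k, e k ≤ B) :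
    (∀ k : ℕ, ∃ j ≤ k, a j ≤ (B - e 0) / (c * (k + 1))) ∧ Tendsto a atTop (nhds 0) := by
  have hsum : ∀ n, c * ∑ j ∈ Finset.range n, a j ≤ B - e 0 := fun n => by
    rw [Finset.mul_sum]
    calc _ ≤ ∑ j ∈ Finset.range n, (e (j + 1) - e j) := Finset.sum_le_sum fun j _ => hinc j
      _ = e n - e 0 := Finset.sum_range_sub e n
      _ ≤ B - e 0 := sub_le_sub_right (hB n) _
  refine ⟨fun k => ?_, ?_⟩
  · by_contra! hlt
    have h1 : ∑ _j ∈ Finset.range (k + 1), (B - e 0) / (c * (k + 1)) <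
        ∑ j ∈ Finset.range (k + 1), a j :=
      Finset.sum_lt_sum_of_nonempty ⟨0, by simp⟩ fun j hj =>
        hlt j (Nat.lt_succ_iff.1 (Finset.mem_range.1 hj))
    have h2 := mul_lt_mul_of_pos_left h1 hc
    have hk : (0 : ℝ) < k + 1 := by positivity
    have h3 : c * ∑ _j ∈ Finset.range (k + 1), (B - e 0) / (c * (k + 1)) = B - e 0 := by
      rw [Finset.sum_const, Finset.card_range, nsmul_eq_mul]
      push_cast
      field_simp
    linarith [hsum (k + 1)]
  · refine (summable_of_sum_range_le (c := (B - e 0) / c) ha fun n => ?_).tendsto_atTop_zero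
    rw [le_div_iff₀ hc, mul_comm]
    exact hsum n

/-- under MFCQ everywhere, the convexity assumption, `0 < α < μ`, and
`0 < T ≤ 2/(L_l + μ)`, the iterates `x_{k+1} = x_k + T v(x_k)` satisfy
`min_{0 ≤ j ≤ k} ‖v(x_j)‖² ≤ (f* − d(x₀)) / (c₁ (k+1))` with `c₁ = T(1 − μT/2)(μ/α − 1) > 0`,
and `‖v(x_k)‖ → 0` as `k → ∞`. -/
theorem stmt10
    {E : Type*} [NormedAddCommGroup E] [InnerProductSpace ℝ E] [FiniteDimensional ℝ E]
    {ng nh : ℕ} (hng : 0 < ng) (hnh : 0 < nh)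
    (f : E → ℝ) (g : Fin ng → E → ℝ) (h : Fin nh → E → ℝ)
    (gf : E → E) (gg : Fin ng → E → E) (gh : Fin nh → E → E)
    (hf : ∀ y, HasGradientAt f (gf y) y)
    (hg : ∀ i y, HasGradientAt (g i) (gg i y) y)
    (hh : ∀ j y, HasGradientAt (h j) (gh j y) y)
    (hgfc : Continuous gf) (hggc : ∀ i, Continuous (gg i)) (hghc : ∀ j, Continuous (gh j))
    -- Lipschitz gradients
    (Lf Lg Lh : ℝ)
    (hgfL : ∀ y z, ‖gf y - gf z‖ ≤ Lf * ‖y - z‖)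
    (hggL : ∀ i y z, ‖gg i y - gg i z‖ ≤ Lg * ‖y - z‖)
    (hghL : ∀ j y z, ‖gh j y - gh j z‖ ≤ Lh * ‖y - z‖)
    -- MFCQ at every point
    (mfcq : ∀ x : E, LinearIndependent ℝ (fun j : Fin nh => gh j x) ∧
      ∃ w : E, (∀ j : Fin nh, ⟪gh j x, w⟫ = 0) ∧
        ∀ i : Fin ng, g i x ≤ 0 → 0 < ⟪gg i x, w⟫)
    -- convexity assumption
    (hhaff : ∀ j, ConvexOn ℝ Set.univ (h j) ∧ ConcaveOn ℝ Set.univ (h j))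
    (hgconc : ∀ i, ConcaveOn ℝ Set.univ (g i))
    {μ : ℝ} (hμ : 0 < μ) (hfsc : StrongConvexOn Set.univ μ f)
    (hcoer : Tendsto f (cocompact E) atTop)
    (hCne : {y : E | (∀ i, 0 ≤ g i y) ∧ ∀ j, h j y = 0}.Nonempty)
    (hCbd : Bornology.IsBounded {y : E | (∀ i, 0 ≤ g i y) ∧ ∀ j, h j y = 0})
    (xstar : E) (hxsC : (∀ i, 0 ≤ g i xstar) ∧ ∀ j, h j xstar = 0)
    (hxsmin : ∀ y : E, ((∀ i, 0 ≤ g i y) ∧ ∀ j, h j y = 0) → f xstar ≤ f y)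
    -- parameter range
    {α : ℝ} (hα0 : 0 < α) (hαμ : α < μ)
    -- the maximizer `λ(·) = (lamh ·, lamg ·) ∈ D_x` of the dual, and the dual function `d`
    (lamh : E → Fin nh → ℝ) (lamg : E → Fin ng → ℝ)
    (hlam_nn : ∀ y i, 0 ≤ lamg y i)
    (hlam_supp : ∀ y i, 0 < g i y → lamg y i = 0)
    (dval : E → ℝ)
    (hd_eq : ∀ y : E, dval y =
      (f y - ((∑ j : Fin nh, lamh y j * h j y) + ∑ i : Fin ng, lamg y i * g i y)) -
        1/(2*α) * ‖gf y - ((∑ j : Fin nh, lamh y j • gh j y) +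
          ∑ i : Fin ng, lamg y i • gg i y)‖^2)
    (hd_max : ∀ (y : E) (lh : Fin nh → ℝ) (lg : Fin ng → ℝ),
      (∀ i, 0 ≤ lg i) → (∀ i, 0 < g i y → lg i = 0) →
      (f y - ((∑ j : Fin nh, lh j * h j y) + ∑ i : Fin ng, lg i * g i y)) -
        1/(2*α) * ‖gf y - ((∑ j : Fin nh, lh j • gh j y) +
          ∑ i : Fin ng, lg i • gg i y)‖^2 ≤ dval y)
    -- the velocity field `v(·)` and its relation to `λ(·)`
    (vfun : E → E)
    (hv_mem : ∀ y : E, (∀ j : Fin nh, ⟪gh j y, vfun y⟫ + α * h j y = 0) ∧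
      ∀ i : Fin ng, g i y ≤ 0 → 0 ≤ ⟪gg i y, vfun y⟫ + α * g i y)
    (hv_min : ∀ y u : E, (∀ j : Fin nh, ⟪gh j y, u⟫ + α * h j y = 0) →
      (∀ i : Fin ng, g i y ≤ 0 → 0 ≤ ⟪gg i y, u⟫ + α * g i y) →
      1/2 * ‖vfun y + gf y‖^2 ≤ 1/2 * ‖u + gf y‖^2)
    (hv_lam : ∀ y : E, vfun y =
      -(gf y - ((∑ j : Fin nh, lamh y j • gh j y) + ∑ i : Fin ng, lamg y i • gg i y)))
    -- the smoothness constant `L_l` of the Lagrangian with frozen multiplier `λ(x)`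
    {Ll : ℝ} (hμLl : μ ≤ Ll)
    (hLl : ∀ y z z' : E,
      ‖(gf z - ((∑ j : Fin nh, lamh y j • gh j z) + ∑ i : Fin ng, lamg y i • gg i z)) -
        (gf z' - ((∑ j : Fin nh, lamh y j • gh j z') +
          ∑ i : Fin ng, lamg y i • gg i z'))‖ ≤ Ll * ‖z - z'‖)
    -- step size
    {T : ℝ} (hT0 : 0 < T) (hT : T ≤ 2 / (Ll + μ))
    -- the iterates
    (xseq : ℕ → E)
    (hxs : ∀ k : ℕ, xseq (k + 1) = xseq k + T • vfun (xseq k)) :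
    (∀ k : ℕ, ∃ j ≤ k, ‖vfun (xseq j)‖^2 ≤
      (f xstar - dval (xseq 0)) / (T * (1 - μ*T/2) * (μ/α - 1) * (k + 1))) ∧
    Tendsto (fun k => ‖vfun (xseq k)‖) atTop (nhds 0) := by
  have hL0 : 0 < Ll + μ := by linarith
  have hT' : T * (Ll + μ) ≤ 2 := (le_div_iff₀ hL0).1 hT
  have hμT : μ * T ≤ 1 := by nlinarith
  have hαT : α * T ≤ 1 := by nlinarith
  have hμα : 0 < μ / α - 1 := sub_pos.2 ((one_lt_div hα0).2 hαμ)
  have hc : 0 < T * (1 - μ * T / 2) * (μ / α - 1) :=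
    mul_pos (mul_pos hT0 (by linarith)) hμα
  -- the Lagrangian with frozen multiplier and its gradient
  let l : E → E → ℝ := fun y z =>
    f z - ((∑ j, lamh y j * h j z) + ∑ i, lamg y i * g i z)
  let G : E → E → E := fun y z =>
    gf z - ((∑ j, lamh y j • gh j z) + ∑ i, lamg y i • gg i z)
  have hG : ∀ y z, HasGradientAt (l y) (G y z) z := fun y z =>
    (hf z).sub ((HasGradientAt.sum fun j _ => (hh j z).const_mul _).add
      (HasGradientAt.sum fun i _ => (hg i z).const_mul _))
  have hv : ∀ y, G y y = -vfun y := fun y => by rw [hv_lam y, neg_neg]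
  have hd : ∀ y, dval y = l y y - 1 / (2 * α) * ‖vfun y‖ ^ 2 := fun y => by
    rw [hd_eq y, hv_lam y, norm_neg]
  have hlow : ∀ y z z', l y z + ⟪G y z, z' - z⟫ + μ / 2 * ‖z' - z‖ ^ 2 ≤ l y z' :=
    fun y z z' => by
    have h1 := hfsc.add_inner_add_sq_le_of_hasGradientAt (hf z) z'
    have h2 : ∑ j, lamh y j * h j z' = ∑ j, (lamh y j * h j z + ⟪lamh y j • gh j z, z' - z⟫) :=
      Finset.sum_congr rfl fun j _ => by
        rw [real_inner_smul_left, ← mul_add, le_antisymm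
          ((hhaff j).2.le_add_inner_of_hasGradientAt (hh j z) z')
          ((hhaff j).1.add_inner_le_of_hasGradientAt (hh j z) z')]
    have h3 : ∑ i, lamg y i * g i z' ≤ ∑ i, (lamg y i * g i z + ⟪lamg y i • gg i z, z' - z⟫) :=
      Finset.sum_le_sum fun i _ => by
        rw [real_inner_smul_left, ← mul_add]
        exact mul_le_mul_of_nonneg_left
          ((hgconc i).le_add_inner_of_hasGradientAt (hg i z) z') (hlam_nn y i)
    rw [Finset.sum_add_distrib, ← sum_inner] at h2 h3
    simp only [l, G, inner_sub_left, inner_add_left]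
    linarith
  -- weak duality
  have hbound : ∀ y, dval y ≤ f xstar := fun y => by
    have h1 := hlow y y xstar
    rw [hv, inner_neg_left] at h1
    have h2 : l y xstar ≤ f xstar := by
      have h3 : 0 ≤ ∑ i, lamg y i * g i xstar :=
        Finset.sum_nonneg fun i _ => mul_nonneg (hlam_nn y i) (hxsC.1 i)
      simp only [l, hxsC.2, mul_zero, Finset.sum_const_zero]
      linarith
    have h3 := real_inner_le_norm (vfun y) (xstar - y)
    have h4 : ‖vfun y‖ * ‖xstar - y‖ ≤ 1 / (2 * α) * ‖vfun y‖ ^ 2 + α / 2 * ‖xstar - y‖ ^ 2 := by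
      have : 1 / (2 * α) * ‖vfun y‖ ^ 2 + α / 2 * ‖xstar - y‖ ^ 2 - ‖vfun y‖ * ‖xstar - y‖ =
          1 / (2 * α) * (‖vfun y‖ - α * ‖xstar - y‖) ^ 2 := by
        field_simp
        ring
      have : 0 ≤ 1 / (2 * α) * (‖vfun y‖ - α * ‖xstar - y‖) ^ 2 := by positivity
      linarith
    rw [hd]
    nlinarith [sq_nonneg ‖xstar - y‖]
  -- one half of complementary slackness, from optimality of the multiplier
  have hcomp : ∀ y i, 0 < lamg y i → ⟪gg i y, vfun y⟫ + α * g i y ≤ 0 := fun y i hi => by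
    have hle : ∀ s : ℝ, 0 < s → s ≤ lamg y i →
        ⟪gg i y, vfun y⟫ + α * g i y ≤ s / 2 * ‖gg i y‖ ^ 2 := fun s hs hsi => by
      have h1 := hd_max y (lamh y) (fun k => lamg y k - if k = i then s else 0)
        (fun k => by
          by_cases hk : k = i
          · subst hk; simpa using hsi
          · simpa [hk] using hlam_nn y k)
        (fun k hk => by
          have hki : k ≠ i := by
            rintro rfl
            exact hi.ne' (hlam_supp y k hk)
          simpa [hki] using hlam_supp y k hk)
      have e1 : ∑ k, (lamg y k - if k = i then s else 0) * g k y =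
          (∑ k, lamg y k * g k y) - s * g i y := by
        simp [sub_mul, Finset.sum_sub_distrib]
      have e2 : ∑ k, (lamg y k - if k = i then s else 0) • gg k y =
          (∑ k, lamg y k • gg k y) - s • gg i y := by
        simp [sub_smul, Finset.sum_sub_distrib, ite_smul]
      have e3 : gf y - ((∑ j, lamh y j • gh j y) + ((∑ k, lamg y k • gg k y) - s • gg i y)) =
          s • gg i y - vfun y := by
        rw [hv_lam y]
        abel
      rw [e1, e2, e3, hd y, norm_sub_sq_real, norm_smul, mul_pow, Real.norm_eq_abs, sq_abs,
        real_inner_smul_left] at h1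
      simp only [l] at h1
      field_simp at h1
      have : s * (⟪gg i y, vfun y⟫ + α * g i y) ≤ s * (s / 2 * ‖gg i y‖ ^ 2) := by nlinarith
      exact le_of_mul_le_mul_left this hs
    by_contra! hpos
    set A := ⟪gg i y, vfun y⟫ + α * g i y
    set N := ‖gg i y‖ ^ 2
    have hN : 0 ≤ N := sq_nonneg _
    have hs : 0 < min (lamg y i) (A / (N + 1)) := lt_min hi (by positivity)
    have h1 := hle _ hs (min_le_left _ _)
    have h2 : min (lamg y i) (A / (N + 1)) * (N + 1) ≤ A :=
      (le_div_iff₀ (by linarith)).1 (min_le_right _ _)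
    nlinarith
  have hinc : ∀ y, T * (1 - μ * T / 2) * (μ / α - 1) * ‖vfun y‖ ^ 2 ≤
      dval (y + T • vfun y) - dval y := fun y => by
    have hfeas : ∀ i, 0 < g i (y + T • vfun y) → lamg y i = 0 := fun i hi => by
      by_contra hne
      have hpos : 0 < lamg y i := (hlam_nn y i).lt_of_ne' hne
      have hgi : g i y ≤ 0 := not_lt.1 fun hlt => hne (hlam_supp y i hlt)
      have h1 := (hgconc i).le_add_inner_of_hasGradientAt (hg i y) (y + T • vfun y)
      rw [add_sub_cancel_left, real_inner_smul_right] at h1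
      have h2 := mul_le_mul_of_nonneg_left (hcomp y i hpos) hT0.le
      nlinarith
    have h1 : l y (y + T • vfun y) - 1 / (2 * α) * ‖G y (y + T • vfun y)‖ ^ 2 ≤ _ :=
      hd_max (y + T • vfun y) (lamh y) (lamg y) (hlam_nn y) hfeas
    have h2 := hlow y y (y + T • vfun y)
    rw [add_sub_cancel_left, hv, inner_neg_left, real_inner_smul_right,
      real_inner_self_eq_norm_sq, norm_smul, mul_pow, Real.norm_eq_abs, sq_abs] at h2
    have h3 := sq_norm_gradient_step_le hμ hμLl hT0 hT (hG y) (hlow y) (hLl y) y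
    rw [hv, smul_neg, sub_neg_eq_add, norm_neg] at h3
    have h4 := mul_le_mul_of_nonneg_left h3 (show 0 ≤ 1 / (2 * α) by positivity)
    have h5 : T * (1 - μ * T / 2) * (μ / α - 1) * ‖vfun y‖ ^ 2 =
        -(T * ‖vfun y‖ ^ 2) + μ / 2 * (T ^ 2 * ‖vfun y‖ ^ 2) + 1 / (2 * α) * ‖vfun y‖ ^ 2 -
          1 / (2 * α) * ((1 - μ * T) ^ 2 * ‖vfun y‖ ^ 2) := by
      field_simp
      ring
    rw [hd y]
    linarith
  obtain ⟨hrate, hlim⟩ := exists_le_div_and_tendsto_of_sufficient_increase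
    (a := fun k => ‖vfun (xseq k)‖ ^ 2) (e := fun k => dval (xseq k)) hc
    (fun k => sq_nonneg _) (fun k => by simpa only [hxs k] using hinc (xseq k))
    (fun k => hbound _)
  refine ⟨hrate, ?_⟩
  simpa [Real.sqrt_sq (norm_nonneg _)] using hlim.sqrt
end

section
/- (Variant of Barbalat's lemma.) Let r̄ ≥ 0 and let ξ : [0,∞) → ℝ be a measurable function such that: (i) ξ(s) ≤ ξ(t) + r̄(t − s) for all 0 ≤ s ≤ t (this one-sided condition encodes that ξ is piecewise continuous, jumps only upward at discontinuities, and decreases with slope at most r̄ on continuity intervals); (ii) the positive part ξ̄(t) := max{ξ(t), 0} is integrable on [0,∞) and ξ̄(t) → 0 as t → ∞; (iii) the integrals ∫₀ᵀ ξ(τ)dτ are bounded below uniformly over T > 0. Then ξ(t) → 0 as t → ∞. -/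
open MeasureTheory Filter

/-- The increments over windows of fixed length of the primitive of a function integrable on
`(a, ∞)` tend to `0`. -/
theorem tendsto_intervalIntegral_sub_const_atTop {f : ℝ → ℝ} {a : ℝ}
    (hf : IntegrableOn f (Set.Ioi a) volume) (δ : ℝ) :
    Tendsto (fun t => ∫ τ in (t - δ)..t, f τ) atTop (nhds 0) := by
  have h := intervalIntegral_tendsto_integral_Ioi a hf tendsto_id
  have h' := intervalIntegral_tendsto_integral_Ioi a hf
    (tendsto_atTop_add_const_right atTop (-δ) tendsto_id)
  have hsub := h.sub h'
  rw [sub_self] at hsub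
  refine hsub.congr' ?_
  have hint : ∀ b, a ≤ b → IntervalIntegrable f volume a b := fun b hb =>
    (intervalIntegrable_iff_integrableOn_Ioc_of_le hb).2 (hf.mono_set Set.Ioc_subset_Ioi_self)
  filter_upwards [eventually_ge_atTop a, eventually_ge_atTop (a + δ)] with t ht htδ
  exact intervalIntegral.integral_interval_sub_left (hint t ht) (hint (t - δ) (by linarith))

/-- If the positive part of `ξ` is integrable on `[0, ∞)` and the integrals of `ξ` over `[0, T]`
are bounded below, then the negative part of `ξ` is integrable on `(0, ∞)`. -/
theorem integrableOn_Ioi_negPart_of_integral_bddBelow {ξ : ℝ → ℝ} {M : ℝ}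
    (hii : ∀ T : ℝ, IntervalIntegrable ξ volume 0 T)
    (hpos : IntegrableOn (fun t => max (ξ t) 0) (Set.Ici 0) volume)
    (hM : ∀ T : ℝ, 0 < T → M ≤ ∫ τ in (0 : ℝ)..T, ξ τ) :
    IntegrableOn (fun t => max (-ξ t) 0) (Set.Ioi 0) volume := by
  have hposIoi := hpos.mono_set Set.Ioi_subset_Ici_self
  have hneg : ∀ t, max (-ξ t) 0 = max (ξ t) 0 - ξ t := fun t => by
    rcases le_total (ξ t) 0 with h | h
    · rw [max_eq_left (by linarith), max_eq_right h]; ring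
    · rw [max_eq_right (by linarith), max_eq_left h]; ring
  have hposii : ∀ T, 0 ≤ T → IntervalIntegrable (fun t => max (ξ t) 0) volume 0 T := fun T hT =>
    (intervalIntegrable_iff_integrableOn_Ioc_of_le hT).2
      (hposIoi.mono_set Set.Ioc_subset_Ioi_self)
  refine integrableOn_Ioi_of_intervalIntegral_norm_bounded
    ((∫ t in Set.Ioi (0 : ℝ), max (ξ t) 0) - M) 0 (l := atTop) (b := fun t => max t 0)
    (fun T => ?_) (tendsto_atTop_mono (fun t => le_max_left t 0) tendsto_id) ?_
  · refine (intervalIntegrable_iff_integrableOn_Ioc_of_le (le_max_right T 0)).1 ?_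
    simp only [hneg]
    exact (hposii _ (le_max_right T 0)).sub (hii _)
  · filter_upwards [eventually_gt_atTop 0] with T hT
    rw [max_eq_left hT.le]
    have hnorm : ∀ t, ‖max (-ξ t) 0‖ = max (ξ t) 0 - ξ t := fun t => by
      rw [Real.norm_of_nonneg (le_max_right _ _), hneg]
    simp only [hnorm]
    rw [intervalIntegral.integral_sub (hposii T hT.le) (hii T),
      intervalIntegral.integral_of_le hT.le]
    exact sub_le_sub (setIntegral_mono_set hposIoi
      (Eventually.of_forall fun t => le_max_right _ _)
      Set.Ioc_subset_Ioi_self.eventuallyLE) (hM T hT)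

/-- variant of Barbalat's lemma: let `r̄ ≥ 0` and `ξ` be measurable with
(i) `ξ(s) ≤ ξ(t) + r̄ (t − s)` for all `0 ≤ s ≤ t`;
(ii) the positive part `ξ̄(t) = max{ξ(t), 0}` integrable on `[0,∞)` and tending to `0` at `∞`;
(iii) the integrals `∫₀ᵀ ξ` bounded below uniformly over `T > 0`.
Then `ξ(t) → 0` as `t → ∞`. -/
theorem stmt14
    (rbar : ℝ) (hrbar : 0 ≤ rbar)
    (ξ : ℝ → ℝ) (hmeas : Measurable ξ)
    (hii : ∀ T : ℝ, IntervalIntegrable ξ volume 0 T)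
    (hslope : ∀ s t : ℝ, 0 ≤ s → s ≤ t → ξ s ≤ ξ t + rbar * (t - s))
    (hposint : IntegrableOn (fun t => max (ξ t) 0) (Set.Ici 0) volume)
    (hpos0 : Tendsto (fun t => max (ξ t) 0) atTop (nhds 0))
    (hbdd : ∃ M : ℝ, ∀ T : ℝ, 0 < T → M ≤ ∫ τ in (0 : ℝ)..T, ξ τ) :
    Tendsto ξ atTop (nhds 0) := by
  obtain ⟨M, hM⟩ := hbdd
  have hneg := integrableOn_Ioi_negPart_of_integral_bddBelow hii hposint hM
  rw [tendsto_order]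
  refine ⟨fun a ha => ?_, fun a ha => ?_⟩
  · set δ := -a / (2 * (rbar + 1)) with hδ
    have hδ0 : 0 < δ := div_pos (neg_pos.2 ha) (by positivity)
    have hrδ : rbar * δ ≤ -a / 2 := by
      have : (rbar + 1) * δ = -a / 2 := by rw [hδ]; field_simp
      linarith
    have hwin := tendsto_intervalIntegral_sub_const_atTop hneg δ
    have hsmall := hwin.eventually_lt_const (show 0 < δ * (-a / 2) by nlinarith)
    filter_upwards [hsmall, eventually_ge_atTop δ] with t ht htδ
    by_contra! hξ
    have hint : IntervalIntegrable (fun τ => max (-ξ τ) 0) volume (t - δ) t :=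
      (intervalIntegrable_iff_integrableOn_Ioc_of_le (by linarith)).2
        (hneg.mono_set fun x hx => lt_of_le_of_lt (by linarith) hx.1)
    have hlow : ∫ _ in (t - δ)..t, -a / 2 ≤ ∫ τ in (t - δ)..t, max (-ξ τ) 0 := by
      refine intervalIntegral.integral_mono_on (by linarith) intervalIntegrable_const hint
        fun τ hτ => le_max_of_le_left ?_
      have h1 := hslope τ t (by linarith [hτ.1]) hτ.2
      have h2 : rbar * (t - τ) ≤ rbar * δ :=
        mul_le_mul_of_nonneg_left (by linarith [hτ.1]) hrbar
      linarith
    rw [intervalIntegral.integral_const, sub_sub_cancel, smul_eq_mul] at hlow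
    linarith
  · filter_upwards [hpos0.eventually_lt_const ha] with t ht
    exact (le_max_left _ _).trans_lt ht
end

section
/- Let m ≥ 1 and 0 ≤ p ≤ m, let G ∈ ℝ^{m×m} be symmetric positive semidefinite with G = B + C for matrices B, C ∈ ℝ^{m×m}, let q ∈ ℝ^m, and define d̃(μ) := ½ μᵀGμ + qᵀμ. Let D := ℝ^p × ℝ_{≥0}^{m−p} and D* := {0}^p × ℝ_{≤0}^{m−p}. Suppose λ ∈ D and λ⁺ ∈ D satisfy −Bλ⁺ − Cλ − q ∈ D* and (λ⁺)ᵀ(Bλ⁺ + Cλ + q) = 0. Then d̃(λ) − d̃(λ⁺) ≥ ½ (λ − λ⁺)ᵀ (B − C) (λ − λ⁺). -/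
open Matrix

/-- decrease estimate for the projected SOR step.  With `G = B + C` symmetric
positive semidefinite, `d̃(μ) = ½μᵀGμ + qᵀμ`, `D = ℝᵖ × ℝ_{≥0}^{m−p}`,
`D* = {0}ᵖ × ℝ_{≤0}^{m−p}`, if `λ, λ⁺ ∈ D`, `−Bλ⁺ − Cλ − q ∈ D*` and
`(λ⁺)ᵀ(Bλ⁺ + Cλ + q) = 0`, then `d̃(λ) − d̃(λ⁺) ≥ ½(λ − λ⁺)ᵀ(B − C)(λ − λ⁺)`. -/
theorem stmt15
    {m : ℕ} (hm : 1 ≤ m) (p : ℕ) (hp : p ≤ m)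
    (G B C : Matrix (Fin m) (Fin m) ℝ)
    (hGsymm : G.IsSymm) (hGpsd : G.PosSemidef) (hGBC : G = B + C)
    (q : Fin m → ℝ)
    (lam lam' : Fin m → ℝ)
    -- `λ ∈ D` and `λ⁺ ∈ D`
    (hlamD : ∀ i : Fin m, p ≤ (i : ℕ) → 0 ≤ lam i)
    (hlam'D : ∀ i : Fin m, p ≤ (i : ℕ) → 0 ≤ lam' i)
    -- `−Bλ⁺ − Cλ − q ∈ D*`
    (hDstar1 : ∀ i : Fin m, (i : ℕ) < p → (B.mulVec lam' + C.mulVec lam + q) i = 0)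
    (hDstar2 : ∀ i : Fin m, p ≤ (i : ℕ) → -(B.mulVec lam' + C.mulVec lam + q) i ≤ 0)
    -- `(λ⁺)ᵀ(Bλ⁺ + Cλ + q) = 0`
    (hcs : lam' ⬝ᵥ (B.mulVec lam' + C.mulVec lam + q) = 0) :
    (1/2 * (lam ⬝ᵥ G.mulVec lam) + q ⬝ᵥ lam) -
        (1/2 * (lam' ⬝ᵥ G.mulVec lam') + q ⬝ᵥ lam') ≥
      1/2 * ((lam - lam') ⬝ᵥ (B - C).mulVec (lam - lam')) := by
  have hnonneg : 0 ≤ lam ⬝ᵥ (B.mulVec lam' + C.mulVec lam + q) := by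
    refine Finset.sum_nonneg fun i _ => ?_
    rcases lt_or_ge (i : ℕ) p with h | h
    · rw [hDstar1 i h, mul_zero]
    · exact mul_nonneg (hlamD i h) (neg_nonpos.mp (hDstar2 i h))
  have hswap : lam ⬝ᵥ G.mulVec lam' = lam' ⬝ᵥ G.mulVec lam := by
    rw [dotProduct_mulVec, ← mulVec_transpose, hGsymm.eq, dotProduct_comm]
  subst hGBC
  rw [dotProduct_comm q lam, dotProduct_comm q lam']
  simp only [add_mulVec, sub_mulVec, mulVec_sub, dotProduct_add, dotProduct_sub,
    sub_dotProduct] at *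
  linarith
end

section
/- (Convergence of projected successive over-relaxation.) Let m ≥ 1, 0 ≤ p ≤ m, let G ∈ ℝ^{m×m} be symmetric positive semidefinite with strictly positive diagonal entries, write G = Uᵀ + Δ + U with Δ the diagonal part and U the strictly upper triangular part, and fix ω ∈ (0,2); set B := Uᵀ + ω^{−1}Δ and C := U + (1 − ω^{−1})Δ. Let q ∈ ℝ^m, D := ℝ^p × ℝ_{≥0}^{m−p}, D* := {0}^p × ℝ_{≤0}^{m−p}, and d̃(μ) := ½μᵀGμ + qᵀμ, and assume d̃ is bounded below on D. Let (λ^j)_{j≥0} be a sequence with λ^0 ∈ D such that for every j: λ^{j+1} ∈ D, −Bλ^{j+1} − Cλ^j − q ∈ D*, and (λ^{j+1})ᵀ(Bλ^{j+1} + Cλ^j + q) = 0. Then λ^j converges, and its limit λ satisfies λ ∈ D, −Gλ − q ∈ D*, and λᵀ(Gλ + q) = 0; i.e., λ minimizes d̃ over D. -/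
open Matrix Filter

/-- The strictly upper triangular part `U` of a matrix. -/
def upperPart {m : ℕ} (G : Matrix (Fin m) (Fin m) ℝ) : Matrix (Fin m) (Fin m) ℝ :=
  Matrix.of fun i j => if i < j then G i j else 0

/-- The diagonal part `Δ` of a matrix. -/
def diagPart {m : ℕ} (G : Matrix (Fin m) (Fin m) ℝ) : Matrix (Fin m) (Fin m) ℝ :=
  Matrix.diagonal fun i => G i i

/-- The quadratic function `½ xᵀGx + qᵀx`. -/
noncomputable def quadObj {m : ℕ} (G : Matrix (Fin m) (Fin m) ℝ) (q x : Fin m → ℝ) : ℝ :=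
  1/2 * (x ⬝ᵥ G.mulVec x) + q ⬝ᵥ x

lemma Matrix.IsSymm.dotProduct_mulVec_comm {m : ℕ} {A : Matrix (Fin m) (Fin m) ℝ}
    (hA : A.IsSymm) (x y : Fin m → ℝ) : x ⬝ᵥ A.mulVec y = y ⬝ᵥ A.mulVec x := by
  rw [Matrix.dotProduct_mulVec, ← Matrix.mulVec_transpose, hA.eq, dotProduct_comm]

/-- The exact second-order expansion of `quadObj` at `y`. -/
lemma quadObj_eq_add {m : ℕ} {G : Matrix (Fin m) (Fin m) ℝ} (hG : G.IsSymm)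
    (q x y : Fin m → ℝ) :
    quadObj G q x = quadObj G q y + (x - y) ⬝ᵥ (G.mulVec y + q) +
      1/2 * ((x - y) ⬝ᵥ G.mulVec (x - y)) := by
  have h := hG.dotProduct_mulVec_comm x y
  simp only [quadObj, Matrix.mulVec_sub, sub_dotProduct, dotProduct_sub, dotProduct_add,
    dotProduct_comm q]
  linarith

lemma abs_dotProduct_le {m : ℕ} (x y : Fin m → ℝ) : |x ⬝ᵥ y| ≤ m * (‖x‖ * ‖y‖) := by
  calc |x ⬝ᵥ y| ≤ ∑ i, |x i * y i| := Finset.abs_sum_le_sum_abs _ _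
    _ ≤ ∑ _i : Fin m, ‖x‖ * ‖y‖ := by
        refine Finset.sum_le_sum fun i _ => ?_
        rw [abs_mul]
        exact mul_le_mul (norm_le_pi_norm x i) (norm_le_pi_norm y i) (abs_nonneg _)
          (norm_nonneg _)
    _ = m * (‖x‖ * ‖y‖) := by simp

lemma exists_norm_mulVec_le {m : ℕ} (A : Matrix (Fin m) (Fin m) ℝ) :
    ∃ K : ℝ, 0 ≤ K ∧ ∀ x, ‖A.mulVec x‖ ≤ K * ‖x‖ :=
  ⟨‖A.mulVecLin.toContinuousLinearMap‖, norm_nonneg _,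
    fun x => A.mulVecLin.toContinuousLinearMap.le_opNorm x⟩

/-- The quadratic form of a symmetric matrix is controlled by its gradient. -/
lemma exists_abs_quadraticForm_le {m : ℕ} {A : Matrix (Fin m) (Fin m) ℝ} (hA : A.IsSymm) :
    ∃ K : ℝ, 0 ≤ K ∧ ∀ w, |w ⬝ᵥ A.mulVec w| ≤ K * ‖A.mulVec w‖ ^ 2 := by
  obtain ⟨g, hg⟩ := A.mulVecLin.rangeRestrict.exists_rightInverse_of_surjective
    A.mulVecLin.range_rangeRestrict
  refine ⟨m * ‖g.toContinuousLinearMap‖, by positivity, fun w => ?_⟩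
  set v := A.mulVecLin.rangeRestrict w with hv
  have hu : A.mulVec (g v) = A.mulVec w :=
    congrArg Subtype.val (LinearMap.congr_fun hg v)
  have hn : ‖g v‖ ≤ ‖g.toContinuousLinearMap‖ * ‖A.mulVec w‖ :=
    g.toContinuousLinearMap.le_opNorm v
  rw [← hu, hA.dotProduct_mulVec_comm, hu]
  calc |g v ⬝ᵥ A.mulVec w| ≤ m * (‖g v‖ * ‖A.mulVec w‖) := abs_dotProduct_le _ _
    _ ≤ m * ((‖g.toContinuousLinearMap‖ * ‖A.mulVec w‖) * ‖A.mulVec w‖) := by gcongr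
    _ = _ := by ring

/-- On the range of a symmetric idempotent `P`, either the projected gradient of the quadratic
is bounded away from zero, or the quadratic is within a multiple of the squared norm of the
projected gradient of its critical value. -/
lemma quadObj_projected_gradient_dichotomy {m : ℕ} {G P : Matrix (Fin m) (Fin m) ℝ}
    (hG : G.IsSymm) (hP : P.IsSymm) (hPP : P * P = P) (q : Fin m → ℝ) :
    (∃ ε : ℝ, 0 < ε ∧ ∀ x, P.mulVec x = x → ε ≤ ‖P.mulVec (G.mulVec x + q)‖) ∨
    ∃ v K : ℝ, 0 ≤ K ∧ ∀ x, P.mulVec x = x →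
      |quadObj G q x - v| ≤ K * ‖P.mulVec (G.mulVec x + q)‖ ^ 2 := by
  set A := P * G * P with hAdef
  have hA : A.IsSymm := by
    simp only [Matrix.IsSymm, hAdef, Matrix.transpose_mul, hP.eq, hG.eq, Matrix.mul_assoc]
  have hAx : ∀ x, P.mulVec x = x → A.mulVec x = P.mulVec (G.mulVec x) := by
    intro x hx
    rw [hAdef, ← Matrix.mulVec_mulVec, hx, Matrix.mulVec_mulVec]
  by_cases hq : -P.mulVec q ∈ LinearMap.range A.mulVecLin
  · right
    obtain ⟨z, hz⟩ := hq
    obtain ⟨K, hK, hbound⟩ := exists_abs_quadraticForm_le hA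
    have hy : P.mulVec (P.mulVec z) = P.mulVec z := by rw [Matrix.mulVec_mulVec, hPP]
    set y := P.mulVec z with hydef
    have hgrad : P.mulVec (G.mulVec y + q) = 0 := by
      rw [Matrix.mulVec_add, ← hAx y hy, hydef, hAdef, Matrix.mulVec_mulVec, Matrix.mul_assoc,
        hPP, ← hAdef]
      rw [Matrix.mulVecLin_apply] at hz
      rw [hz]; simp
    refine ⟨quadObj G q y, K, hK, fun x hx => ?_⟩
    have hw : P.mulVec (x - y) = x - y := by rw [Matrix.mulVec_sub, hx, hy]
    have hlin : (x - y) ⬝ᵥ (G.mulVec y + q) = 0 := by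
      rw [← hw, dotProduct_comm, hP.dotProduct_mulVec_comm, hgrad, dotProduct_zero]
    have hquad : (x - y) ⬝ᵥ G.mulVec (x - y) = (x - y) ⬝ᵥ A.mulVec (x - y) := by
      rw [hAx _ hw, hP.dotProduct_mulVec_comm, hw, dotProduct_comm]
    have hAw : A.mulVec (x - y) = P.mulVec (G.mulVec x + q) := by
      rw [hAx _ hw, ← sub_zero (P.mulVec (G.mulVec x + q)), ← hgrad, ← Matrix.mulVec_sub,
        Matrix.mulVec_sub]
      congr 1
      abel
    have h := hbound (x - y)
    rw [hAw] at h
    rw [quadObj_eq_add hG q x y, hlin, hquad, hAw, add_zero, add_sub_cancel_left, abs_mul,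
      abs_of_nonneg (by norm_num : (0 : ℝ) ≤ 1/2)]
    linarith [abs_nonneg ((x - y) ⬝ᵥ P.mulVec (G.mulVec x + q))]
  · left
    have hcl : IsClosed (LinearMap.range A.mulVecLin : Set (Fin m → ℝ)) :=
      Submodule.closed_of_finiteDimensional _
    obtain ⟨ε, hε, hball⟩ := Metric.isOpen_iff.1 hcl.isOpen_compl _ hq
    refine ⟨ε, hε, fun x hx => ?_⟩
    by_contra! hlt
    refine hball (a := A.mulVec x) ?_ ⟨x, rfl⟩
    rwa [mem_ball_iff_norm, sub_neg_eq_add, hAx x hx, ← Matrix.mulVec_add]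

/-- A sequence whose squared increments are dominated by the decrease of a null sequence, and
dominate the next term of that null sequence, is Cauchy. -/
lemma cauchySeq_of_sq_dist_le {E : Type*} [PseudoMetricSpace E] {x : ℕ → E} {e : ℕ → ℝ}
    {c K : ℝ} (hc : 0 < c) (hK : 0 ≤ K) (he : ∀ n, 0 ≤ e n)
    (hdec : ∀ n, c * dist (x n) (x (n + 1)) ^ 2 ≤ e n - e (n + 1))
    (hub : ∀ n, e (n + 1) ≤ K * dist (x n) (x (n + 1)) ^ 2) : CauchySeq x := by
  set θ := K / (c + K) with hθ
  have hcK : 0 < c + K := by linarith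
  have hθ0 : 0 ≤ θ := by positivity
  have hθ1 : θ < 1 := by rw [hθ, div_lt_one hcK]; linarith
  have hstep : ∀ n, e (n + 1) ≤ θ * e n := by
    intro n
    rw [hθ, div_mul_eq_mul_div, le_div_iff₀ hcK]
    nlinarith [mul_le_mul_of_nonneg_left (hdec n) hK, mul_le_mul_of_nonneg_left (hub n) hc.le]
  have hgeom : ∀ n, e n ≤ θ ^ n * e 0 := by
    intro n
    induction n with
    | zero => simp
    | succ n ih =>
      calc e (n + 1) ≤ θ * e n := hstep n
        _ ≤ θ * (θ ^ n * e 0) := by gcongr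
        _ = _ := by ring
  refine cauchySeq_of_le_geometric (√θ) (√(e 0 / c))
    ((Real.sqrt_lt' one_pos).2 (by simpa using hθ1)) fun n => ?_
  refine abs_le_of_sq_le_sq' ?_ (by positivity) |>.2
  rw [mul_pow, Real.sq_sqrt (div_nonneg (he 0) hc.le), ← pow_mul, mul_comm n 2, pow_mul,
    Real.sq_sqrt hθ0, div_mul_eq_mul_div, le_div_iff₀ hc]
  linarith [hdec n, hgeom n, he (n + 1)]

lemma exists_pos_mul_sq_norm_le_sum {m : ℕ} (hm : 1 ≤ m) {a : Fin m → ℝ} (ha : ∀ i, 0 < a i) :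
    ∃ c : ℝ, 0 < c ∧ ∀ x : Fin m → ℝ, c * ‖x‖ ^ 2 ≤ ∑ i, a i * x i ^ 2 := by
  have : Nonempty (Fin m) := ⟨⟨0, hm⟩⟩
  obtain ⟨k, hk⟩ := Finite.exists_min a
  refine ⟨a k, ha k, fun x => ?_⟩
  obtain ⟨i, hi⟩ := Finite.exists_max fun i => ‖x i‖
  have hx : ‖x‖ ≤ ‖x i‖ := (pi_norm_le_iff_of_nonneg (norm_nonneg _)).2 hi
  calc a k * ‖x‖ ^ 2 ≤ a i * ‖x i‖ ^ 2 := by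
        have := (ha i).le
        gcongr
        exact hk i
    _ = a i * x i ^ 2 := by rw [Real.norm_eq_abs, sq_abs]
    _ ≤ _ := Finset.single_le_sum (f := fun i => a i * x i ^ 2)
        (fun i _ => mul_nonneg (ha i).le (sq_nonneg _)) (Finset.mem_univ i)

lemma transpose_upperPart_add_diagPart_add_upperPart {m : ℕ} {G : Matrix (Fin m) (Fin m) ℝ}
    (hG : G.IsSymm) : (upperPart G)ᵀ + diagPart G + upperPart G = G := by
  ext i j
  simp only [upperPart, diagPart, Matrix.add_apply, Matrix.transpose_apply, Matrix.of_apply,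
    Matrix.diagonal_apply]
  rcases lt_trichotomy i j with h | rfl | h
  · simp [h, h.ne, h.not_gt]
  · simp
  · simp [h, h.ne', h.not_gt, hG.apply i j]

lemma dotProduct_mulVec_diagPart {m : ℕ} (G : Matrix (Fin m) (Fin m) ℝ) (x : Fin m → ℝ) :
    x ⬝ᵥ (diagPart G).mulVec x = ∑ i, G i i * x i ^ 2 := by
  simp only [dotProduct, diagPart, Matrix.mulVec_diagonal]
  exact Finset.sum_congr rfl fun i _ => by ring

/-- The residual of one relaxation step, in terms of the gradient at the new iterate. -/
lemma sor_residual_eq {m : ℕ} {G : Matrix (Fin m) (Fin m) ℝ} (hG : G.IsSymm) (ω : ℝ)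
    (q x z : Fin m → ℝ) :
    ((upperPart G)ᵀ + ω⁻¹ • diagPart G).mulVec z +
      (upperPart G + (1 - ω⁻¹) • diagPart G).mulVec x + q =
    G.mulVec z + q - (upperPart G + (1 - ω⁻¹) • diagPart G).mulVec (z - x) := by
  have h : (upperPart G)ᵀ + ω⁻¹ • diagPart G =
      G - (upperPart G + (1 - ω⁻¹) • diagPart G) := by
    rw [sub_smul, one_smul, eq_sub_iff_add_eq]
    conv_rhs => rw [← transpose_upperPart_add_diagPart_add_upperPart hG]
    abel
  rw [h, Matrix.sub_mulVec, Matrix.mulVec_sub]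
  abel

lemma half_quadraticForm_sub_sor {m : ℕ} {G : Matrix (Fin m) (Fin m) ℝ} (hG : G.IsSymm)
    (ω : ℝ) (x : Fin m → ℝ) :
    1/2 * (x ⬝ᵥ G.mulVec x) - x ⬝ᵥ (upperPart G + (1 - ω⁻¹) • diagPart G).mulVec x =
      (ω⁻¹ - 1/2) * ∑ i, G i i * x i ^ 2 := by
  have h : x ⬝ᵥ (upperPart G)ᵀ.mulVec x = x ⬝ᵥ (upperPart G).mulVec x := by
    rw [Matrix.mulVec_transpose, dotProduct_comm, ← Matrix.dotProduct_mulVec]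
  have h2 : x ⬝ᵥ G.mulVec x = 2 * (x ⬝ᵥ (upperPart G).mulVec x) +
      x ⬝ᵥ (diagPart G).mulVec x := by
    conv_lhs => rw [← transpose_upperPart_add_diagPart_add_upperPart hG]
    rw [Matrix.add_mulVec, Matrix.add_mulVec, dotProduct_add, dotProduct_add, h]
    ring
  rw [h2, ← dotProduct_mulVec_diagPart, Matrix.add_mulVec, Matrix.smul_mulVec, dotProduct_add,
    dotProduct_smul, smul_eq_mul]
  ring

/-- Along a sequence of vectors whose gradient vanishes, up to a null error, on their supports,
the values of a quadratic approach their limit at least as fast as the squared error. -/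
lemma exists_eventually_quadObj_sub_le {m : ℕ} {G : Matrix (Fin m) (Fin m) ℝ} (hG : G.IsSymm)
    (q : Fin m → ℝ) {x a : ℕ → Fin m → ℝ} {v : ℝ}
    (hgrad : ∀ j i, x j i ≠ 0 → (G.mulVec (x j) + q) i = a j i)
    (ha : Tendsto (fun j => ‖a j‖) atTop (nhds 0))
    (hv : Tendsto (fun j => quadObj G q (x j)) atTop (nhds v)) :
    ∃ K : ℝ, 0 ≤ K ∧ ∀ᶠ j in atTop, quadObj G q (x j) - v ≤ K * ‖a j‖ ^ 2 := by
  classical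
  have key : ∀ F : Finset (Fin m), ∃ K : ℝ, 0 ≤ K ∧ ∀ᶠ j in atTop,
      Finset.univ.filter (fun i => x j i ≠ 0) = F → quadObj G q (x j) - v ≤ K * ‖a j‖ ^ 2 := by
    intro F
    by_cases hfreq : ∃ᶠ j in atTop, Finset.univ.filter (fun i => x j i ≠ 0) = F
    swap
    · exact ⟨0, le_rfl, (not_frequently.1 hfreq).mono fun j h h' => absurd h' h⟩
    set P : Matrix (Fin m) (Fin m) ℝ := Matrix.diagonal fun i => if i ∈ F then 1 else 0 with hPdef
    have hP : P.IsSymm := Matrix.diagonal_transpose _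
    have hPP : P * P = P := by simp [hPdef, Matrix.diagonal_mul_diagonal]
    have hPx : ∀ j, Finset.univ.filter (fun i => x j i ≠ 0) = F → P.mulVec (x j) = x j := by
      rintro j rfl
      ext i
      by_cases h : x j i = 0 <;> simp [hPdef, Matrix.mulVec_diagonal, h]
    have hPg : ∀ j, Finset.univ.filter (fun i => x j i ≠ 0) = F →
        ‖P.mulVec (G.mulVec (x j) + q)‖ ≤ ‖a j‖ := by
      rintro j rfl
      refine (pi_norm_le_iff_of_nonneg (norm_nonneg _)).2 fun i => ?_
      rw [hPdef, Matrix.mulVec_diagonal]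
      by_cases h : x j i = 0
      · simp [h]
      · simpa [h, hgrad j i h] using norm_le_pi_norm (a j) i
    rcases quadObj_projected_gradient_dichotomy hG hP hPP q with ⟨ε, hε, hfar⟩ | ⟨u, K, hK, hnear⟩
    · obtain ⟨j, hj, hlt⟩ := (hfreq.and_eventually (ha.eventually (gt_mem_nhds hε))).exists
      exact absurd ((hfar _ (hPx j hj)).trans (hPg j hj)) hlt.not_ge
    · have hbd : ∀ j, Finset.univ.filter (fun i => x j i ≠ 0) = F →
          |quadObj G q (x j) - u| ≤ K * ‖a j‖ ^ 2 := fun j hj =>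
        (hnear _ (hPx j hj)).trans (by have := hPg j hj; gcongr)
      have hlim : Tendsto (fun j => K * ‖a j‖ ^ 2 - |quadObj G q (x j) - u|) atTop
          (nhds (K * 0 ^ 2 - |v - u|)) :=
        ((ha.pow 2).const_mul K).sub (hv.sub_const u).abs
      have huv : 0 ≤ K * 0 ^ 2 - |v - u| :=
        ge_of_tendsto_of_frequently hlim (hfreq.mono fun j hj => sub_nonneg.2 (hbd j hj))
      have : v = u := by
        have h0 : |v - u| ≤ 0 := by linarith
        exact sub_eq_zero.1 (abs_nonpos_iff.1 h0)
      subst this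
      exact ⟨K, hK, .of_forall fun j hj => (le_abs_self _).trans (hbd j hj)⟩
  choose K hK hev using key
  refine ⟨∑ F, K F, Finset.sum_nonneg fun F _ => hK F, ?_⟩
  filter_upwards [eventually_all.2 hev] with j hj
  refine (hj _ rfl).trans ?_
  gcongr
  exact Finset.single_le_sum (fun F _ => hK F) (Finset.mem_univ _)

/-- convergence of projected successive over-relaxation: with `G` symmetric
positive semidefinite with positive diagonal, `G = Uᵀ + Δ + U`, `ω ∈ (0,2)`,
`B = Uᵀ + ω⁻¹Δ`, `C = U + (1 − ω⁻¹)Δ`, `d̃(μ) = ½μᵀGμ + qᵀμ` bounded below on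
`D = ℝᵖ × ℝ_{≥0}^{m−p}`, any sequence `(λʲ)` of projected SOR iterates converges, and the
limit `λ` satisfies `λ ∈ D`, `−Gλ − q ∈ D*`, `λᵀ(Gλ + q) = 0`, i.e. it minimizes `d̃`
over `D`. -/
theorem stmt16
    {m : ℕ} (hm : 1 ≤ m) (p : ℕ) (hp : p ≤ m)
    (G : Matrix (Fin m) (Fin m) ℝ)
    (hGsymm : G.IsSymm) (hGpsd : G.PosSemidef) (hGdiag : ∀ i, 0 < G i i)
    (ω : ℝ) (hω0 : 0 < ω) (hω2 : ω < 2)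
    (q : Fin m → ℝ)
    -- `d̃` is bounded below on `D`
    (hbdd : ∃ M : ℝ, ∀ μv : Fin m → ℝ, (∀ i : Fin m, p ≤ (i : ℕ) → 0 ≤ μv i) →
      M ≤ 1/2 * (μv ⬝ᵥ G.mulVec μv) + q ⬝ᵥ μv)
    -- the projected SOR sequence, with `B = Uᵀ + ω⁻¹Δ` and `C = U + (1 − ω⁻¹)Δ`
    (lam : ℕ → Fin m → ℝ)
    (hlam0 : ∀ i : Fin m, p ≤ (i : ℕ) → 0 ≤ lam 0 i)
    (hstep : ∀ j : ℕ,
      (∀ i : Fin m, p ≤ (i : ℕ) → 0 ≤ lam (j + 1) i) ∧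
      (∀ i : Fin m, (i : ℕ) < p →
        (((upperPart G)ᵀ + ω⁻¹ • diagPart G).mulVec (lam (j + 1)) +
          (upperPart G + (1 - ω⁻¹) • diagPart G).mulVec (lam j) + q) i = 0) ∧
      (∀ i : Fin m, p ≤ (i : ℕ) →
        0 ≤ (((upperPart G)ᵀ + ω⁻¹ • diagPart G).mulVec (lam (j + 1)) +
          (upperPart G + (1 - ω⁻¹) • diagPart G).mulVec (lam j) + q) i) ∧
      lam (j + 1) ⬝ᵥ (((upperPart G)ᵀ + ω⁻¹ • diagPart G).mulVec (lam (j + 1)) +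
        (upperPart G + (1 - ω⁻¹) • diagPart G).mulVec (lam j) + q) = 0) :
    ∃ lamstar : Fin m → ℝ,
      Tendsto lam atTop (nhds lamstar) ∧
      (∀ i : Fin m, p ≤ (i : ℕ) → 0 ≤ lamstar i) ∧
      (∀ i : Fin m, (i : ℕ) < p → (G.mulVec lamstar + q) i = 0) ∧
      (∀ i : Fin m, p ≤ (i : ℕ) → 0 ≤ (G.mulVec lamstar + q) i) ∧
      lamstar ⬝ᵥ (G.mulVec lamstar + q) = 0 ∧
      ∀ μv : Fin m → ℝ, (∀ i : Fin m, p ≤ (i : ℕ) → 0 ≤ μv i) →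
        1/2 * (lamstar ⬝ᵥ G.mulVec lamstar) + q ⬝ᵥ lamstar ≤
          1/2 * (μv ⬝ᵥ G.mulVec μv) + q ⬝ᵥ μv := by
  set B := (upperPart G)ᵀ + ω⁻¹ • diagPart G with hB
  set C := upperPart G + (1 - ω⁻¹) • diagPart G with hC
  have hlamD : ∀ j, ∀ i : Fin m, p ≤ (i : ℕ) → 0 ≤ lam j i := by
    rintro (_ | j)
    · exact hlam0
    · exact (hstep j).1
  have hres : ∀ x z, B.mulVec z + C.mulVec x + q = G.mulVec z + q - C.mulVec (z - x) :=
    fun x z => sor_residual_eq hGsymm ω q x z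
  have hnonneg : ∀ j (μ : Fin m → ℝ), (∀ i : Fin m, p ≤ (i : ℕ) → 0 ≤ μ i) → ∀ i,
      0 ≤ μ i * (B.mulVec (lam (j + 1)) + C.mulVec (lam j) + q) i := by
    intro j μ hμ i
    rcases lt_or_ge (i : ℕ) p with h | h
    · rw [(hstep j).2.1 i h, mul_zero]
    · exact mul_nonneg (hμ i h) ((hstep j).2.2.1 i h)
  have hgrad : ∀ j i, lam (j + 1) i ≠ 0 →
      (G.mulVec (lam (j + 1)) + q) i = C.mulVec (lam (j + 1) - lam j) i := by
    intro j i hi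
    have h := (Finset.sum_eq_zero_iff_of_nonneg fun i _ => hnonneg j _ (hlamD (j + 1)) i).1
      (hstep j).2.2.2 i (Finset.mem_univ i)
    have h' := (mul_eq_zero.1 h).resolve_left hi
    rw [hres] at h'
    exact sub_eq_zero.1 h'
  obtain ⟨c₀, hc₀, hnorm⟩ := exists_pos_mul_sq_norm_le_sum hm hGdiag
  have hω : 0 < ω⁻¹ - 1/2 := by
    have := (inv_lt_inv₀ two_pos hω0).2 hω2
    linarith
  set c := (ω⁻¹ - 1/2) * c₀ with hc
  have hcpos : 0 < c := mul_pos hω hc₀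
  have hdesc : ∀ j, c * ‖lam (j + 1) - lam j‖ ^ 2 ≤
      quadObj G q (lam j) - quadObj G q (lam (j + 1)) := by
    intro j
    have hexp := quadObj_eq_add hGsymm q (lam j) (lam (j + 1))
    have hr : G.mulVec (lam (j + 1)) + q = B.mulVec (lam (j + 1)) + C.mulVec (lam j) + q +
        C.mulVec (lam (j + 1) - lam j) := by rw [hres]; abel
    have hsum := half_quadraticForm_sub_sor hGsymm ω (lam (j + 1) - lam j)
    have hpos : 0 ≤ lam j ⬝ᵥ (B.mulVec (lam (j + 1)) + C.mulVec (lam j) + q) :=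
      Finset.sum_nonneg fun i _ => hnonneg j _ (hlamD j) i
    have hle := mul_le_mul_of_nonneg_left (hnorm (lam (j + 1) - lam j)) hω.le
    rw [hr, dotProduct_add, sub_dotProduct, (hstep j).2.2.2, ← neg_sub (lam (j + 1)) (lam j),
      Matrix.mulVec_neg, neg_dotProduct, neg_dotProduct, dotProduct_neg, neg_neg] at hexp
    rw [← hC] at hsum
    rw [hc, mul_assoc]
    linarith
  have hanti : Antitone fun j => quadObj G q (lam j) := antitone_nat_of_succ_le fun j => by
    have := hdesc j
    have : 0 ≤ c * ‖lam (j + 1) - lam j‖ ^ 2 := by positivity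
    linarith
  obtain ⟨M, hM⟩ := hbdd
  have hbb : BddBelow (Set.range fun j => quadObj G q (lam j)) :=
    ⟨M, by rintro _ ⟨j, rfl⟩; exact hM _ (hlamD j)⟩
  have hlim := tendsto_atTop_ciInf hanti hbb
  set v := ⨅ j, quadObj G q (lam j) with hv
  have hlim' := (tendsto_add_atTop_iff_nat 1).2 hlim
  have hsq : Tendsto (fun j => ‖lam (j + 1) - lam j‖ ^ 2) atTop (nhds 0) := by
    have h0 := (hlim.sub hlim').div_const c
    rw [sub_self, zero_div] at h0
    refine squeeze_zero (fun j => by positivity) (fun j => ?_) h0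
    rw [le_div_iff₀ hcpos, mul_comm]
    exact hdesc j
  have hdiff : Tendsto (fun j => ‖lam (j + 1) - lam j‖) atTop (nhds 0) := by
    have := hsq.sqrt
    simpa [Real.sqrt_sq (norm_nonneg _)] using this
  obtain ⟨L, hL, hCL⟩ := exists_norm_mulVec_le C
  have ha : Tendsto (fun j => ‖C.mulVec (lam (j + 1) - lam j)‖) atTop (nhds 0) :=
    squeeze_zero (fun j => norm_nonneg _) (fun j => hCL _) (by simpa using hdiff.const_mul L)
  obtain ⟨K, hK, hev⟩ := exists_eventually_quadObj_sub_le hGsymm q hgrad ha hlim'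
  obtain ⟨N, hN⟩ := eventually_atTop.1 hev
  have hcauchy : CauchySeq fun n => lam (n + N) := by
    refine cauchySeq_of_sq_dist_le (e := fun n => quadObj G q (lam (n + N)) - v)
      (K := K * L ^ 2) hcpos (by positivity) (fun n => sub_nonneg.2 (ciInf_le hbb _))
      (fun n => ?_) fun n => ?_
    · rw [dist_comm, dist_eq_norm, add_right_comm n 1 N]
      linarith [hdesc (n + N)]
    · rw [dist_comm, dist_eq_norm, add_right_comm n 1 N]
      refine (hN (n + N) (Nat.le_add_left _ _)).trans ?_
      rw [mul_assoc, ← mul_pow]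
      have := hCL (lam (n + N + 1) - lam (n + N))
      gcongr
  obtain ⟨lamstar, hshift⟩ := cauchySeq_tendsto_of_complete hcauchy
  have hconv : Tendsto lam atTop (nhds lamstar) := (tendsto_add_atTop_iff_nat N).1 hshift
  have hconv' := (tendsto_add_atTop_iff_nat 1).2 hconv
  have hrconv : Tendsto (fun j => B.mulVec (lam (j + 1)) + C.mulVec (lam j) + q) atTop
      (nhds (G.mulVec lamstar + q)) := by
    have hcont : ∀ A : Matrix (Fin m) (Fin m) ℝ, Continuous fun x => A.mulVec x :=
      fun A => A.mulVecLin.continuous_of_finiteDimensional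
    have h := ((((hcont B).tendsto _).comp hconv').add
      (((hcont C).tendsto _).comp hconv)).add_const q
    rw [hres, sub_self, Matrix.mulVec_zero, sub_zero] at h
    exact h
  have hD : ∀ i : Fin m, p ≤ (i : ℕ) → 0 ≤ lamstar i := fun i hi =>
    ge_of_tendsto' (tendsto_pi_nhds.1 hconv i) fun j => hlamD j i hi
  have heq : ∀ i : Fin m, (i : ℕ) < p → (G.mulVec lamstar + q) i = 0 := fun i hi =>
    tendsto_nhds_unique (tendsto_pi_nhds.1 hrconv i)
      (tendsto_const_nhds.congr fun j => ((hstep j).2.1 i hi).symm)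
  have hge : ∀ i : Fin m, p ≤ (i : ℕ) → 0 ≤ (G.mulVec lamstar + q) i := fun i hi =>
    ge_of_tendsto' (tendsto_pi_nhds.1 hrconv i) fun j => (hstep j).2.2.1 i hi
  have hcompl : lamstar ⬝ᵥ (G.mulVec lamstar + q) = 0 := by
    have h : Tendsto (fun j => lam (j + 1) ⬝ᵥ (B.mulVec (lam (j + 1)) + C.mulVec (lam j) + q))
        atTop (nhds (lamstar ⬝ᵥ (G.mulVec lamstar + q))) :=
      tendsto_finsetSum _ fun i _ =>
        (tendsto_pi_nhds.1 hconv' i).mul (tendsto_pi_nhds.1 hrconv i)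
    exact tendsto_nhds_unique h (tendsto_const_nhds.congr fun j => (hstep j).2.2.2.symm)
  refine ⟨lamstar, hconv, hD, heq, hge, hcompl, fun μv hμ => ?_⟩
  have hexp := quadObj_eq_add hGsymm q μv lamstar
  have hpos : 0 ≤ μv ⬝ᵥ (G.mulVec lamstar + q) := Finset.sum_nonneg fun i _ => by
    rcases lt_or_ge (i : ℕ) p with h | h
    · rw [heq i h, mul_zero]
    · exact mul_nonneg (hμ i h) (hge i h)
  have hpsd : 0 ≤ (μv - lamstar) ⬝ᵥ G.mulVec (μv - lamstar) := by
    simpa using hGpsd.dotProduct_mulVec_nonneg (μv - lamstar)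
  rw [sub_dotProduct, hcompl] at hexp
  change quadObj G q lamstar ≤ quadObj G q μv
  linarith
end

section
/- Let f : ℝ^n → ℝ be differentiable with L-Lipschitz gradient and with a global minimizer x_f, and let g : ℝ^n → ℝ be differentiable, μ_g-strongly concave with L_g-Lipschitz gradient, with global maximizer x_g satisfying g(x_g) > 0. Fix α ≥ 0 and x ∈ ℝ^n with g(x) ≤ 0, so that (with this single inequality constraint and no equality constraints) V_α(x) = {v ∈ ℝ^n : ⟨∇g(x), v⟩ + α g(x) ≥ 0}. Let v ∈ V_α(x) minimize ½|v + ∇f(x)|² over V_α(x), and suppose λ > 0 satisfies λ∇g(x) = v + ∇f(x). Then λ ≤ (1/μ_g) ( α + L (1 + |x_f − x_g| √(L_g/(2 g(x_g)))) ). -/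
open scoped RealInnerProductSpace

theorem HasGradientAt.hasDerivAt_comp_line_s17
    {E : Type*} [NormedAddCommGroup E] [InnerProductSpace ℝ E] [CompleteSpace E]
    {g : E → ℝ} {g' x d : E} {t : ℝ} (h : HasGradientAt g g' (x + t • d)) :
    HasDerivAt (fun s : ℝ => g (x + s • d)) ⟪g', d⟫ t := by
  have hl : HasDerivAt (fun s : ℝ => x + s • d) d t := by
    simpa using ((hasDerivAt_id t).smul_const d).const_add x
  have hc := h.hasFDerivAt.comp_hasDerivAt t hl
  simp only [InnerProductSpace.toDual_apply_apply] at hc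
  exact hc

/-- First-order characterization of strong concavity. -/
theorem StrongConcaveOn.add_le_inner_gradient
    {E : Type*} [NormedAddCommGroup E] [InnerProductSpace ℝ E] [CompleteSpace E]
    {g : E → ℝ} {m : ℝ} (hg : StrongConcaveOn Set.univ m g) {g' x : E}
    (h : HasGradientAt g g' x) (y : E) :
    g y - g x + m / 2 * ‖x - y‖ ^ 2 ≤ ⟪g', y - x⟫ := by
  have hd : HasDerivAt (fun s : ℝ => g (x + s • (y - x))) ⟪g', y - x⟫ 0 :=
    HasGradientAt.hasDerivAt_comp_line_s17 (by simpa using h)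
  have hlim := hd.tendsto_slope_zero_right
  have hc : Filter.Tendsto (fun t : ℝ => g y - g x + (1 - t) * (m / 2 * ‖x - y‖ ^ 2))
      (nhdsWithin 0 (Set.Ioi 0)) (nhds (g y - g x + m / 2 * ‖x - y‖ ^ 2)) := by
    have : Continuous (fun t : ℝ => g y - g x + (1 - t) * (m / 2 * ‖x - y‖ ^ 2)) := by
      fun_prop
    simpa using (this.tendsto 0).mono_left nhdsWithin_le_nhds
  refine le_of_tendsto_of_tendsto hc hlim ?_
  filter_upwards [Ioo_mem_nhdsGT (zero_lt_one' ℝ)] with t ht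
  have key := hg.2 (Set.mem_univ x) (Set.mem_univ y) (sub_nonneg.2 ht.2.le) ht.1.le (by ring)
  have e : (1 - t) • x + t • y = x + t • (y - x) := by module
  rw [e] at key
  simp only [smul_eq_mul] at key
  simp only [zero_add, zero_smul, add_zero, smul_eq_mul]
  rw [inv_mul_eq_div, le_div_iff₀ ht.1]
  linarith

/-- A function with `K`-Lipschitz gradient decreases at most quadratically from a critical
point. -/
theorem sub_le_of_lipschitz_gradient_of_gradient_eq_zero
    {E : Type*} [NormedAddCommGroup E] [InnerProductSpace ℝ E] [CompleteSpace E]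
    {g : E → ℝ} {g' : E → E} {K : ℝ} (hg : ∀ y, HasGradientAt g (g' y) y)
    (hK : ∀ y z, ‖g' y - g' z‖ ≤ K * ‖y - z‖) {a : E} (ha : g' a = 0) (x : E) :
    g a - g x ≤ K / 2 * ‖x - a‖ ^ 2 := by
  have hd : ∀ t : ℝ, HasDerivAt
      (fun s : ℝ => g (a + s • (x - a)) + K / 2 * ‖x - a‖ ^ 2 * s ^ 2)
      (⟪g' (a + t • (x - a)), x - a⟫ + K / 2 * ‖x - a‖ ^ 2 * (2 * t)) t := by
    intro t
    have hp : HasDerivAt (fun s : ℝ => K / 2 * ‖x - a‖ ^ 2 * s ^ 2)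
        (K / 2 * ‖x - a‖ ^ 2 * (2 * t)) t := by
      simpa using (hasDerivAt_pow 2 t).const_mul (K / 2 * ‖x - a‖ ^ 2)
    exact (hg _).hasDerivAt_comp_line_s17.add hp
  have hm := monotoneOn_of_deriv_nonneg (convex_Icc (0 : ℝ) 1)
    (fun t _ => (hd t).continuousAt.continuousWithinAt)
    (fun t _ => (hd t).differentiableAt.differentiableWithinAt) (by
      intro t ht
      rw [interior_Icc] at ht
      rw [(hd t).deriv]
      have h1 := hK (a + t • (x - a)) a
      rw [ha, sub_zero, add_sub_cancel_left, norm_smul, Real.norm_of_nonneg ht.1.le] at h1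
      have h2 := neg_le_of_abs_le (abs_real_inner_le_norm (g' (a + t • (x - a))) (x - a))
      have h3 := mul_le_mul_of_nonneg_right h1 (norm_nonneg (x - a))
      linarith)
  have := hm (Set.left_mem_Icc.2 zero_le_one) (Set.right_mem_Icc.2 zero_le_one) zero_le_one
  simp at this
  linarith

theorem HasGradientAt.eq_zero_of_isLocalExtr
    {E : Type*} [NormedAddCommGroup E] [InnerProductSpace ℝ E] [CompleteSpace E]
    {g : E → ℝ} {g' a : E} (h : HasGradientAt g g' a) (ha : IsLocalExtr g a) : g' = 0 := by
  simpa using ha.hasFDerivAt_eq_zero h.hasFDerivAt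

/-- bound on the dual multiplier for a single nonlinear inequality constraint.
If `f` has `L`-Lipschitz gradient with global minimizer `x_f`, `g` is `μ_g`-strongly concave
with `L_g`-Lipschitz gradient and global maximizer `x_g` with `g(x_g) > 0`, `α ≥ 0`,
`g(x) ≤ 0`, `v` minimizes `½‖v + ∇f(x)‖²` over `V_α(x) = {v : ⟨∇g(x), v⟩ + αg(x) ≥ 0}`, and
`λ > 0` satisfies `λ∇g(x) = v + ∇f(x)`, then
`λ ≤ (1/μ_g)(α + L(1 + ‖x_f − x_g‖ √(L_g/(2g(x_g)))))`. -/
theorem stmt17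
    {E : Type*} [NormedAddCommGroup E] [InnerProductSpace ℝ E] [FiniteDimensional ℝ E]
    (f : E → ℝ) (gf : E → E) (hf : ∀ y, HasGradientAt f (gf y) y)
    {L : ℝ} (hL : 0 ≤ L) (hgfL : ∀ y z, ‖gf y - gf z‖ ≤ L * ‖y - z‖)
    (xf : E) (hxf : ∀ y, f xf ≤ f y)
    (g : E → ℝ) (gG : E → E) (hgrad : ∀ y, HasGradientAt g (gG y) y)
    {μg : ℝ} (hμg : 0 < μg) (hgsc : StrongConcaveOn Set.univ μg g)
    {Lg : ℝ} (hLg : 0 < Lg) (hgGL : ∀ y z, ‖gG y - gG z‖ ≤ Lg * ‖y - z‖)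
    (xg : E) (hxg : ∀ y, g y ≤ g xg) (hgxg : 0 < g xg)
    {α : ℝ} (hα : 0 ≤ α)
    (x : E) (hx : g x ≤ 0)
    (v : E)
    (hv_mem : 0 ≤ ⟪gG x, v⟫ + α * g x)
    (hv_min : ∀ u : E, 0 ≤ ⟪gG x, u⟫ + α * g x →
      1/2 * ‖v + gf x‖^2 ≤ 1/2 * ‖u + gf x‖^2)
    {lam : ℝ} (hlam0 : 0 < lam) (hlam : lam • gG x = v + gf x) :
    lam ≤ 1/μg * (α + L * (1 + ‖xf - xg‖ * Real.sqrt (Lg / (2 * g xg)))) := by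
  have hgf0 : gf xf = 0 := (hf xf).eq_zero_of_isLocalExtr
    (Or.inl (Filter.Eventually.of_forall hxf))
  have hgG0 : gG xg = 0 := (hgrad xg).eq_zero_of_isLocalExtr
    (Or.inr (Filter.Eventually.of_forall hxg))
  have hfo := hgsc.add_le_inner_gradient (hgrad x) xg
  have hfo' := hgsc.add_le_inner_gradient (hgrad xg) x
  rw [hgG0, inner_zero_left, norm_sub_rev] at hfo'
  have hdesc := sub_le_of_lipschitz_gradient_of_gradient_eq_zero hgrad hgGL hgG0 x
  have hcs := real_inner_le_norm (gG x) (xg - x)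
  rw [norm_sub_rev xg x] at hcs
  have hgfx := hgfL x xf
  rw [hgf0, sub_zero] at hgfx
  have htri : ‖x - xf‖ ≤ ‖x - xg‖ + ‖xf - xg‖ := by
    simpa [norm_sub_rev xf xg] using norm_sub_le_norm_sub_add_norm_sub x xg xf
  have hcs' := real_inner_le_norm (gG x) (gf x)
  have hr : 0 < ‖x - xg‖ := by
    rw [norm_pos_iff, sub_ne_zero]
    rintro rfl
    linarith
  have hD : 0 ≤ ‖xf - xg‖ := norm_nonneg _
  set S := Real.sqrt (Lg / (2 * g xg)) with hS
  have hS0 : 0 ≤ S := Real.sqrt_nonneg _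
  have hSr : 1 ≤ S * ‖x - xg‖ := by
    have hS2 : S ^ 2 = Lg / (2 * g xg) := Real.sq_sqrt (by positivity)
    have : 1 ≤ (S * ‖x - xg‖) ^ 2 := by
      rw [mul_pow, hS2, div_mul_eq_mul_div, le_div_iff₀ (by positivity)]
      linarith
    exact (one_le_sq_iff₀ (by positivity)).1 this
  set B := 1 / μg * (α + L * (1 + ‖xf - xg‖ * S)) with hB
  have hB0 : 0 ≤ B := by positivity
  set r := ‖x - xg‖
  set d := ‖gG x‖ with hd
  have hdr : μg * r ≤ d := by
    refine le_of_mul_le_mul_right ?_ hr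
    linarith
  have hd0 : 0 < d := lt_of_lt_of_le (by positivity) hdr
  have hgx : μg * (-g x) ≤ d ^ 2 := by
    nlinarith [sq_nonneg (d - μg * r), mul_pos hμg hgxg, sq_nonneg d]
  have hSd : μg ≤ S * d := by
    nlinarith [mul_le_mul_of_nonneg_left hdr hS0]
  have hmain : d * ‖gf x‖ - α * g x ≤ B * d ^ 2 := by
    have h1 : ‖gf x‖ ≤ L * (r + ‖xf - xg‖) :=
      hgfx.trans (mul_le_mul_of_nonneg_left htri hL)
    have h2 : μg * (B * d ^ 2) = (α + L * (1 + ‖xf - xg‖ * S)) * d ^ 2 := by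
      rw [hB]
      field_simp
    refine le_of_mul_le_mul_left ?_ hμg
    rw [h2]
    have h3 := mul_le_mul_of_nonneg_left h1 (mul_pos hμg hd0).le
    have h4 := mul_le_mul_of_nonneg_left hgx hα
    have h5 := mul_le_mul_of_nonneg_left hdr (mul_nonneg hL hd0.le)
    have h6 := mul_le_mul_of_nonneg_left hSd (mul_nonneg (mul_nonneg hL hD) hd0.le)
    linarith
  have hmin := hv_min (B • gG x - gf x) (by
    rw [inner_sub_right, inner_smul_right, real_inner_self_eq_norm_sq]
    linarith)
  rw [sub_add_cancel, ← hlam, norm_smul, norm_smul, Real.norm_of_nonneg hlam0.le,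
    Real.norm_of_nonneg hB0, ← hd] at hmin
  have hsq : (lam * d) ^ 2 ≤ (B * d) ^ 2 := by linarith
  exact le_of_mul_le_mul_right ((sq_le_sq₀ (by positivity) (by positivity)).1 hsq) hd0
end
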